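/- There is an absolute constant C > 0 with the following property. Let p be a prime with log log p > 0 and let A ⊆ F_p be a nonempty set with |A + A| ≤ K·|A| for some real K ≥ 1. Then S(4A − 4A) ≤ C · (p / |A|³) · exp(C·(log log p)³·(log K)²), where 4A − 4A = A + A + A + A − A − A − A − A. -/

import Mathlib

open Finset Pointwise

/-- The set of nonzero quadratic residues in `F_p`. -/
def quadRes (p : ℕ) [Fact p.Prime] : Finset (ZMod p) :=
  Finset.univ.filter fun x => ∃ y : ZMod p, y ≠ 0 ∧ y ^ 2 = x

section Stepanov
open Polynomial
variable {p : ℕ} [Fact p.Prime]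

/-- The operators describing iterated derivatives of `c * X ^ (p * j) * f ^ e` when `e = lam`. -/
noncomputable def stepanovOp (f : (ZMod p)[X]) (lam : ZMod p) :
    ℕ → ((ZMod p)[X] →ₗ[ZMod p] (ZMod p)[X])
  | 0 => LinearMap.id
  | i + 1 => LinearMap.mulLeft (ZMod p) f ∘ₗ derivative ∘ₗ stepanovOp f lam i +
      LinearMap.mulLeft (ZMod p) (C (lam - i) * derivative f) ∘ₗ stepanovOp f lam i

theorem stepanovOp_succ (f : (ZMod p)[X]) (lam : ZMod p) (i : ℕ) (c : (ZMod p)[X]) :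
    stepanovOp f lam (i + 1) c = f * derivative (stepanovOp f lam i c) +
      C (lam - i) * derivative f * stepanovOp f lam i c := rfl

theorem natDegree_stepanovOp_le (f : (ZMod p)[X]) (lam : ZMod p) (c : (ZMod p)[X]) (i : ℕ) :
    (stepanovOp f lam i c).natDegree ≤ c.natDegree + i * f.natDegree := by
  induction i with
  | zero => simp [stepanovOp]
  | succ i ih =>
    rw [stepanovOp_succ]
    refine (natDegree_add_le _ _).trans (max_le ?_ ?_)
    · refine natDegree_mul_le.trans ?_
      have := natDegree_derivative_le (stepanovOp f lam i c)
      rw [add_mul]; omega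
    · rw [mul_assoc]
      refine (natDegree_C_mul_le _ _).trans (natDegree_mul_le.trans ?_)
      have := natDegree_derivative_le f
      rw [add_mul]; omega

theorem pow_mul_iterate_derivative (f c : (ZMod p)[X]) (e j i : ℕ) :
    f ^ i * derivative^[i] (c * X ^ (p * j) * f ^ e) =
      stepanovOp f (e : ZMod p) i c * X ^ (p * j) * f ^ e := by
  induction i with
  | zero => simp [stepanovOp]
  | succ i ih =>
    have h1 := congrArg (fun q => f * derivative q) ih
    simp only [derivative_mul, derivative_pow] at h1
    have h0 : ((p * j : ℕ) : ZMod p) = 0 := by simp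
    simp only [h0, map_zero, zero_mul, mul_zero, add_zero] at h1
    rw [Function.iterate_succ_apply', stepanovOp_succ]
    have h2 : ∀ k : ℕ, f * (C (k : ZMod p) * f ^ (k - 1) * derivative f) =
        C (k : ZMod p) * f ^ k * derivative f := by
      intro k
      cases k with
      | zero => simp
      | succ k => simp only [Nat.add_sub_cancel]; ring
    have h3 := h2 i
    have h4 := h2 e
    simp only [map_sub, map_natCast] at *
    linear_combination h1 - (derivative^[i] (c * X ^ (p * j) * f ^ e)) * h3 -
      (i : (ZMod p)[X]) * derivative f * ih + stepanovOp f (e : ZMod p) i c * X ^ (p * j) * h4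

/-- The polynomial with given coefficients. -/
noncomputable def coeffPoly (E : ℕ) : (Fin E → ZMod p) →ₗ[ZMod p] (ZMod p)[X] :=
  (degreeLT (ZMod p) E).subtype ∘ₗ (degreeLTEquiv (ZMod p) E).symm.toLinearMap

theorem coeffPoly_injective (E : ℕ) : Function.Injective (coeffPoly (p := p) E) :=
  Subtype.val_injective.comp (degreeLTEquiv (ZMod p) E).symm.injective

theorem degree_coeffPoly_lt (E : ℕ) (v : Fin E → ZMod p) : (coeffPoly E v).degree < E :=
  mem_degreeLT.1 ((degreeLTEquiv (ZMod p) E).symm v).2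

/-- Solve the linear system of Stepanov's method. -/
theorem exists_stepanov_coeffs (f : (ZMod p)[X]) (eps lam : ZMod p) (E J l : ℕ) (hE : 0 < E)
    (h : l * (E + l * f.natDegree + J) < 2 * (J * E)) :
    ∃ c e : Fin J → (ZMod p)[X], (∀ j, (c j).degree < E) ∧ (∀ j, (e j).degree < E) ∧
      (c ≠ 0 ∨ e ≠ 0) ∧ ∀ i < l, ∑ j : Fin J, X ^ (j : ℕ) *
        (stepanovOp f 0 i (c j) + C eps * stepanovOp f lam i (e j)) = 0 := by
  classical
  set M := E + l * f.natDegree + J with hM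
  let V := Fin J → Fin E → ZMod p
  let P : ℕ → (V × V →ₗ[ZMod p] (ZMod p)[X]) := fun i =>
    ∑ j : Fin J, LinearMap.mulLeft (ZMod p) (X ^ (j : ℕ)) ∘ₗ
      (stepanovOp f 0 i ∘ₗ coeffPoly E ∘ₗ LinearMap.proj j ∘ₗ LinearMap.fst (ZMod p) V V +
       LinearMap.mulLeft (ZMod p) (C eps) ∘ₗ stepanovOp f lam i ∘ₗ coeffPoly E ∘ₗ
        LinearMap.proj j ∘ₗ LinearMap.snd (ZMod p) V V)
  let L : V × V →ₗ[ZMod p] (Fin l × Fin M → ZMod p) :=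
    LinearMap.pi fun x => lcoeff (ZMod p) (x.2 : ℕ) ∘ₗ P x.1
  have hker : LinearMap.ker L ≠ ⊥ := by
    apply LinearMap.ker_ne_bot_of_finrank_lt
    simp only [V, Module.finrank_prod, Module.finrank_pi_fintype, Module.finrank_self,
      Finset.sum_const, Finset.card_univ, Fintype.card_fin, Fintype.card_prod, smul_eq_mul]
    simp only [mul_one]
    omega
  obtain ⟨v, hv, hv0⟩ := (Submodule.ne_bot_iff _).1 hker
  have hP : ∀ i (v : V × V), P i v = ∑ j : Fin J, X ^ (j : ℕ) *
        (stepanovOp f 0 i (coeffPoly E (v.1 j)) +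
          C eps * stepanovOp f lam i (coeffPoly E (v.2 j))) := by
    intro i v
    simp [P, LinearMap.sum_apply]
    rfl
  have hdeg : ∀ (w : Fin E → ZMod p) (mu : ZMod p) i, i < l →
      (stepanovOp f mu i (coeffPoly E w)).natDegree < E + l * f.natDegree := by
    intro w mu i hi
    have h1 := natDegree_stepanovOp_le f mu (coeffPoly E w) i
    have h2 : (coeffPoly E w).natDegree < E := by
      by_cases h0 : coeffPoly E w = 0
      · simpa [h0] using hE
      · exact (natDegree_lt_iff_degree_lt h0).2 (degree_coeffPoly_lt E w)
    have h3 : i * f.natDegree ≤ l * f.natDegree := Nat.mul_le_mul_right _ hi.le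
    omega
  refine ⟨fun j => coeffPoly E (v.1 j), fun j => coeffPoly E (v.2 j),
    fun j => degree_coeffPoly_lt _ _, fun j => degree_coeffPoly_lt _ _, ?_, ?_⟩
  · by_contra! hcon
    apply hv0
    ext1 <;> funext j
    · exact coeffPoly_injective E ((congrFun hcon.1 j).trans (map_zero _).symm)
    · exact coeffPoly_injective E ((congrFun hcon.2 j).trans (map_zero _).symm)
  · intro i hi
    rw [← hP]
    ext n
    rw [coeff_zero]
    by_cases hn : n < M
    · have := congrFun (LinearMap.mem_ker.1 hv) (⟨i, hi⟩, ⟨n, hn⟩)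
      simpa [L] using this
    · apply coeff_eq_zero_of_natDegree_lt
      refine lt_of_lt_of_le ?_ (not_lt.1 hn)
      rw [hP]
      refine (natDegree_sum_le_of_forall_le (n := M - 1) _ _ fun j _ => ?_).trans_lt (by omega)
      refine natDegree_mul_le.trans ?_
      rw [natDegree_X_pow]
      have h1 := hdeg (v.1 j) 0 i hi
      have h2 := hdeg (v.2 j) lam i hi
      have h3 := natDegree_C_mul_le eps (stepanovOp f lam i (coeffPoly E (v.2 j)))
      have h4 := natDegree_add_le (stepanovOp f 0 i (coeffPoly E (v.1 j)))
        (C eps * stepanovOp f lam i (coeffPoly E (v.2 j)))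
      have := j.2
      omega


theorem stepanov_count (hp2 : p ≠ 2) (f : (ZMod p)[X]) (hf : f.rootMultiplicity 0 = 1)
    (eps : ZMod p) (Z : Finset (ZMod p)) (hZ0 : ∀ u ∈ Z, f.eval u ≠ 0)
    (hZ : ∀ u ∈ Z, f.eval u ^ (p / 2) = eps) (J l : ℕ) (hl : l ≤ p)
    (h : l * (p / 2 + l * f.natDegree + J) < 2 * (J * (p / 2))) :
    l * #Z ≤ p * (J + f.natDegree) := by
  classical
  have hp := (Fact.out : p.Prime)
  have hp3 : 2 < p := lt_of_le_of_ne hp.two_le (Ne.symm hp2)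
  set E := p / 2 with hEdef
  have hE : 0 < E := by omega
  have hEp : 2 * E + 1 = p := by
    have := hp.eq_two_or_odd; omega
  obtain ⟨c, e, hc, he, hne, hsol⟩ := exists_stepanov_coeffs f eps (E : ZMod p) E J l hE h
  set G : (ZMod p)[X] := ∑ j : Fin J, (c j * X ^ (p * (j : ℕ)) * f ^ 0 +
    e j * X ^ (p * (j : ℕ)) * f ^ E) with hG
  have hf0 : f ≠ 0 := by rintro rfl; simp at hf
  have hlt : ∀ (q : (ZMod p)[X]), q.degree < E → q.natDegree < E := by
    intro q hq
    by_cases h0 : q = 0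
    · simpa [h0] using hE
    · exact (natDegree_lt_iff_degree_lt h0).2 hq
  have hXdvd : ∀ (q : (ZMod p)[X]), q.degree < E → (X ^ E ∣ q) → q = 0 := by
    intro q hq hd
    by_contra h0
    have := natDegree_le_of_dvd hd h0
    rw [natDegree_X_pow] at this
    have := hlt q hq
    omega
  have hfX : X ∣ f := by
    have := (rootMultiplicity_pos hf0 (x := (0 : ZMod p))).1 (by omega)
    simpa using dvd_iff_isRoot.2 this
  have hG0 : G ≠ 0 := by
    intro hGz
    have hex : ∃ j : Fin J, c j ≠ 0 ∨ e j ≠ 0 := by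
      rcases hne with h | h
      · obtain ⟨j, hj⟩ := Function.ne_iff.1 h; exact ⟨j, Or.inl hj⟩
      · obtain ⟨j, hj⟩ := Function.ne_iff.1 h; exact ⟨j, Or.inr hj⟩
    have hwf := WellFounded.has_min (wellFounded_lt (α := Fin J)) {j | c j ≠ 0 ∨ e j ≠ 0} hex
    obtain ⟨j, hj, hmin⟩ := hwf
    have hdv : X ^ (p * (j : ℕ) + p) ∣ (c j + e j * f ^ E) * X ^ (p * (j : ℕ)) := by
      have h1 : (c j + e j * f ^ E) * X ^ (p * (j : ℕ)) = G - ∑ i ∈ univ.erase j,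
          (c i * X ^ (p * (i : ℕ)) * f ^ 0 + e i * X ^ (p * (i : ℕ)) * f ^ E) := by
        rw [hG, ← Finset.add_sum_erase _ _ (Finset.mem_univ j)]; ring
      rw [h1, hGz, zero_sub, dvd_neg]
      refine Finset.dvd_sum fun i hi => ?_
      have hij := (Finset.mem_erase.1 hi).1
      rcases lt_or_gt_of_ne hij with hlt' | hgt
      · have := hmin i
        have hz : c i = 0 ∧ e i = 0 := by
          by_contra hcon
          exact hmin i (by rw [Set.mem_ofPred_eq]; tauto) hlt'
        simp [hz.1, hz.2]
      · have h2 : (X : (ZMod p)[X]) ^ (p * (j : ℕ) + p) ∣ X ^ (p * (i : ℕ)) := by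
          apply pow_dvd_pow
          have : (j : ℕ) + 1 ≤ i := hgt
          calc p * (j : ℕ) + p = p * ((j : ℕ) + 1) := by ring
            _ ≤ _ := Nat.mul_le_mul_left _ this
        exact dvd_add (Dvd.dvd.mul_right (Dvd.dvd.mul_left h2 _) _)
          (Dvd.dvd.mul_right (Dvd.dvd.mul_left h2 _) _)
    rw [add_comm, pow_add] at hdv
    have hdv2 : X ^ p ∣ c j + e j * f ^ E :=
      (mul_dvd_mul_iff_right (pow_ne_zero _ X_ne_zero)).1 hdv
    have hXf : (X : (ZMod p)[X]) ^ E ∣ f ^ E := pow_dvd_pow_of_dvd hfX E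
    have hcj : c j = 0 := by
      apply hXdvd _ (hc j)
      have h3 : (X : (ZMod p)[X]) ^ E ∣ c j + e j * f ^ E :=
        (pow_dvd_pow _ (by omega)).trans hdv2
      exact (dvd_add_left (hXf.mul_left _)).1 h3
    rw [hcj, zero_add] at hdv2
    have hej : e j ≠ 0 := by
      rcases hj with h | h
      · exact absurd hcj h
      · exact h
    have hmul : e j * f ^ E ≠ 0 := mul_ne_zero hej (pow_ne_zero _ hf0)
    have h4 : p ≤ (e j * f ^ E).rootMultiplicity 0 :=
      (le_rootMultiplicity_iff hmul).2 (by simpa using hdv2)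
    rw [rootMultiplicity_mul hmul, ← count_roots (f ^ E), roots_pow, Multiset.count_nsmul,
      count_roots, hf] at h4
    have h5 : (e j).rootMultiplicity 0 ≤ (e j).natDegree :=
      (rootMultiplicity_le_iff hej 0 _).2 (by
        intro hd
        have := natDegree_le_of_dvd hd hej
        simp at this)
    have := hlt _ (he j)
    omega
  have hGdeg : G.natDegree ≤ p * (J + f.natDegree) := by
    refine natDegree_sum_le_of_forall_le _ _ fun j _ => ?_
    have hj : p * ((j : ℕ) + 1) ≤ p * J := Nat.mul_le_mul_left _ j.2
    have h1 : (c j * X ^ (p * (j : ℕ)) * f ^ 0).natDegree ≤ E + p * j := by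
      rw [pow_zero, mul_one]
      refine natDegree_mul_le.trans ?_
      rw [natDegree_X_pow]
      have := hlt _ (hc j); omega
    have h2 : (e j * X ^ (p * (j : ℕ)) * f ^ E).natDegree ≤ E + p * j + E * f.natDegree := by
      refine natDegree_mul_le.trans (add_le_add (natDegree_mul_le.trans ?_) natDegree_pow_le)
      rw [natDegree_X_pow]
      have := hlt _ (he j); omega
    have h3 : E * f.natDegree ≤ p * f.natDegree := Nat.mul_le_mul_right _ (by omega)
    refine (natDegree_add_le _ _).trans ?_
    rw [mul_add] at *
    refine max_le ?_ ?_ <;> omega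
  have hmult : ∀ u ∈ Z, l ≤ G.rootMultiplicity u := by
    intro u hu
    rcases Nat.eq_zero_or_pos l with h0 | hlpos
    · omega
    have hroot : ∀ i < l, (derivative^[i] G).IsRoot u := by
      intro i hi
      have h1 : f ^ i * derivative^[i] G = ∑ j : Fin J, X ^ (p * (j : ℕ)) *
          (stepanovOp f 0 i (c j) + stepanovOp f (E : ZMod p) i (e j) * f ^ E) := by
        rw [hG, iterate_derivative_sum, Finset.mul_sum]
        refine Finset.sum_congr rfl fun j _ => ?_
        rw [iterate_map_add, mul_add, pow_mul_iterate_derivative,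
          pow_mul_iterate_derivative]
        simp only [pow_zero, Nat.cast_zero]
        ring
      have h2 := congrArg (eval u) h1
      have h3 := congrArg (eval u) (hsol i hi)
      simp only [eval_mul, eval_pow, eval_finsetSum, eval_X, eval_add, eval_C, eval_zero,
        pow_mul, ZMod.pow_card, hZ u hu] at h2 h3
      have h4 : f.eval u ^ i * (derivative^[i] G).eval u = 0 := by
        rw [h2]
        refine Eq.trans ?_ h3
        refine Finset.sum_congr rfl fun j _ => ?_
        ring
      exact (mul_eq_zero.1 h4).resolve_left (pow_ne_zero _ (hZ0 u hu))
    have hfac : ((l - 1).factorial : ZMod p) ∈ nonZeroDivisors (ZMod p) := by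
      rw [mem_nonZeroDivisors_iff_ne_zero, Ne, ZMod.natCast_eq_zero_iff, hp.dvd_factorial]
      omega
    have := (lt_rootMultiplicity_iff_isRoot_iterate_derivative_of_mem_nonZeroDivisors
      (t := u) hG0 hfac).2 (fun m hm => hroot m (by omega))
    omega
  calc l * #Z = ∑ u ∈ Z, l := by rw [Finset.sum_const, smul_eq_mul, mul_comm]
    _ ≤ ∑ u ∈ Z, G.roots.count u := Finset.sum_le_sum fun u hu => by
        rw [count_roots]; exact hmult u hu
    _ ≤ G.roots.card := by
        rw [← Multiset.toFinset_sum_count_eq]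
        refine (Finset.sum_le_sum_of_ne_zero fun u _ hu => ?_)
        rw [Multiset.mem_toFinset]
        exact Multiset.count_ne_zero.1 hu
    _ ≤ _ := (card_roots' G).trans hGdeg

theorem card_quadraticChar_prod_eq_le (hp2 : p ≠ 2) (hp9 : 9 ≤ p) (I : Finset (ZMod p))
    (h0 : (0 : ZMod p) ∈ I) (eps : ℤ) (heps : eps ≠ 0) :
    (#{u : ZMod p | ∏ d ∈ I, quadraticChar (ZMod p) (u + d) = eps} : ℝ) ≤
      p / 2 + 10 * #I * √p := by
  classical
  set f : (ZMod p)[X] := ∏ d ∈ I, (X + C d) with hf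
  have hdeg : f.natDegree = #I := by
    rw [hf, natDegree_prod_of_monic _ _ fun d _ => monic_X_add_C d]
    simp
  have hmult : f.rootMultiplicity 0 = 1 := by
    have hf' : f = ((I.map (Equiv.neg (ZMod p)).toEmbedding).val.map fun a => X - C a).prod := by
      rw [hf, ← Finset.prod_eq_multiset_prod, Finset.prod_map]
      simp
    rw [← count_roots, hf', roots_multiset_prod_X_sub_C]
    apply Multiset.count_eq_one_of_mem
    · exact Finset.nodup _
    · rw [Finset.mem_val, Finset.mem_map]; exact ⟨0, h0, by simp⟩
  set Z : Finset (ZMod p) := {u : ZMod p | ∏ d ∈ I, quadraticChar (ZMod p) (u + d) = eps} with hZ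
  have hev : ∀ u, f.eval u = ∏ d ∈ I, (u + d) := by intro u; simp [hf, eval_prod]
  have hchar : ringChar (ZMod p) ≠ 2 := by rwa [ZMod.ringChar_zmod_n]
  set q := Nat.sqrt p with hq
  have hq1 : q * q ≤ p := Nat.sqrt_le p
  have hq2 : p < (q + 1) * (q + 1) := Nat.sqrt_lt.1 (Nat.lt_succ_self _)
  have hq3 : 3 ≤ q := Nat.le_sqrt.2 hp9
  set m := #I with hm
  set J := q / 2 + 2 * m + 2 with hJ
  have hodd : 2 * (p / 2) + 1 = p := by
    have := (Fact.out : p.Prime).eq_two_or_odd; omega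
  have key : q * #Z ≤ p * (J + f.natDegree) := by
    refine stepanov_count hp2 f hmult (eps : ZMod p) Z ?_ ?_ J q (Nat.sqrt_le_self p) ?_
    · intro u hu he
      rw [hev, ← quadraticChar_eq_zero_iff, map_prod] at he
      rw [hZ, Finset.mem_filter] at hu
      exact heps (hu.2 ▸ he)
    · intro u hu
      rw [hZ, Finset.mem_filter] at hu
      have := quadraticChar_eq_pow_of_char_ne_two' hchar (f.eval u)
      rw [ZMod.card] at this
      rw [← this, hev, map_prod, hu.2]
    · rw [hdeg]
      have e1 : q ≤ 2 * (q / 2) + 1 := by omega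
      set h := q / 2
      set E := p / 2
      have : (q : ℤ) ≤ 2 * h + 1 := by exact_mod_cast e1
      have hh2 : 2 * (h : ℤ) ≤ q := by omega
      have hpE : (p : ℤ) = 2 * E + 1 := by omega
      have hq1' : (q : ℤ) * q ≤ p := by exact_mod_cast hq1
      have hq3' : (3 : ℤ) ≤ q := by exact_mod_cast hq3
      have hm0 : (0 : ℤ) ≤ m := by positivity
      zify
      rw [hJ]
      push_cast
      nlinarith [mul_nonneg hm0 (by nlinarith : (0:ℤ) ≤ 2 * E + 1 - 2 - 2 * q)]
  rw [hdeg] at key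
  have hqs : √(p : ℝ) ≤ 2 * q := by
    rw [Real.sqrt_le_left (by positivity)]
    have : ((p : ℕ) : ℝ) < (q + 1) * (q + 1) := by exact_mod_cast hq2
    have h3 : (3 : ℝ) ≤ q := by exact_mod_cast hq3
    nlinarith
  have hps : √(p : ℝ) * √p = p := Real.mul_self_sqrt (by positivity)
  have keyR : (q : ℝ) * #Z ≤ p * (q / 2 + 3 * m + 2) := by
    have h1 : ((q * #Z : ℕ) : ℝ) ≤ ((p * (J + m) : ℕ) : ℝ) := by exact_mod_cast key
    push_cast at h1
    refine h1.trans (mul_le_mul_of_nonneg_left ?_ (by positivity))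
    rw [hJ]; push_cast
    have : ((q / 2 : ℕ) : ℝ) ≤ q / 2 := Nat.cast_div_le
    linarith
  have hm1 : (1 : ℝ) ≤ m := by exact_mod_cast Finset.card_pos.2 ⟨0, h0⟩
  have hqpos : (0 : ℝ) < q := by positivity
  refine le_of_mul_le_mul_left (keyR.trans ?_) hqpos
  have h2 : (p : ℝ) * (3 * m + 2) ≤ q * (10 * m * √p) := by
    have : (3 * (m : ℝ) + 2) ≤ 5 * m := by linarith
    calc (p : ℝ) * (3 * m + 2) = √(p : ℝ) * √p * (3 * m + 2) := by rw [hps]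
      _ ≤ √(p : ℝ) * (2 * q) * (5 * m) := by gcongr
      _ = _ := by ring
  linarith

/-- A Weil-type bound for quadratic character sums of products of distinct linear factors. -/
theorem abs_sum_prod_quadraticChar_le (hp2 : p ≠ 2) (I : Finset (ZMod p)) (hI : I.Nonempty) :
    |((∑ u : ZMod p, ∏ d ∈ I, quadraticChar (ZMod p) (u + d) : ℤ) : ℝ)| ≤ 21 * #I * √p := by
  classical
  wlog h0 : (0 : ZMod p) ∈ I generalizing I
  · obtain ⟨d0, hd0⟩ := hI
    have h1 := this (I.image fun d => d - d0) ⟨0, Finset.mem_image.2 ⟨d0, hd0, sub_self _⟩⟩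
      (Finset.mem_image.2 ⟨d0, hd0, sub_self _⟩)
    have hinj : Function.Injective fun d : ZMod p => d - d0 := sub_left_injective
    rw [Finset.card_image_of_injective _ hinj] at h1
    convert h1 using 3
    rw [← Equiv.sum_comp (Equiv.subRight d0)]
    refine Finset.sum_congr rfl fun u _ => ?_
    rw [Finset.prod_image fun a _ b _ h => hinj h]
    refine Finset.prod_congr rfl fun d _ => ?_
    congr 1
    simp only [Equiv.subRight_apply]
    ring
  have hm1 : (1 : ℝ) ≤ #I := by exact_mod_cast Finset.card_pos.2 ⟨0, h0⟩
  have hps : √(p : ℝ) * √p = p := Real.mul_self_sqrt (by positivity)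
  have hp1 : (1 : ℝ) ≤ p := by exact_mod_cast (Fact.out : p.Prime).one_lt.le
  have hs1 : 1 ≤ √(p : ℝ) := by rw [Real.one_le_sqrt]; exact hp1
  set g : ZMod p → ℤ := fun u => ∏ d ∈ I, quadraticChar (ZMod p) (u + d) with hg
  have hval : ∀ u, g u = 0 ∨ g u = 1 ∨ g u = -1 := by
    intro u
    simp only [hg, ← map_prod]
    have := quadraticChar_isQuadratic (ZMod p) (∏ d ∈ I, (u + d))
    exact this
  have hsum : ((∑ u, g u : ℤ)) = (#{u | g u = 1} : ℤ) - #{u | g u = -1} := by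
    rw [Finset.card_filter, Finset.card_filter]
    push_cast
    rw [← Finset.sum_sub_distrib]
    refine Finset.sum_congr rfl fun u _ => ?_
    rcases hval u with h | h | h <;> simp [h]
  have hcount : #{u | g u = 1} + #{u | g u = -1} + #{u | g u = 0} = p := by
    conv_rhs => rw [← ZMod.card p, ← Finset.card_univ, Finset.card_eq_sum_ones]
    simp only [Finset.card_filter]
    rw [← Finset.sum_add_distrib, ← Finset.sum_add_distrib]
    refine Finset.sum_congr rfl fun u _ => ?_
    rcases hval u with h | h | h <;> simp [h]
  have hzero : #{u | g u = 0} ≤ #I := by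
    have : ({u | g u = 0} : Finset (ZMod p)) ⊆ I.image fun d => -d := by
      intro u hu
      rw [Finset.mem_filter] at hu
      obtain ⟨d, hd, h⟩ := Finset.prod_eq_zero_iff.1 hu.2
      rw [quadraticChar_eq_zero_iff] at h
      exact Finset.mem_image.2 ⟨d, hd, (eq_neg_of_add_eq_zero_left h).symm⟩
    exact (Finset.card_le_card this).trans Finset.card_image_le
  have hcountR : (#{u | g u = 1} : ℝ) + #{u | g u = -1} + #{u | g u = 0} = p := by
    exact_mod_cast hcount
  have hzeroR : (#{u | g u = 0} : ℝ) ≤ #I := by exact_mod_cast hzero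
  have hmI : (#I : ℝ) ≤ #I * √p := by nlinarith
  rw [hsum]
  push_cast
  by_cases hp9 : 9 ≤ p
  · have h1 := card_quadraticChar_prod_eq_le hp2 hp9 I h0 1 one_ne_zero
    have h2 := card_quadraticChar_prod_eq_le hp2 hp9 I h0 (-1) (by norm_num)
    rw [abs_le]
    constructor <;> linarith
  · have hp9' : (p : ℝ) < 9 := by exact_mod_cast not_le.1 hp9
    have hs3 : √(p : ℝ) ≤ 3 := by rw [Real.sqrt_le_left (by norm_num)]; linarith
    have : (p : ℝ) ≤ 21 * #I * √p := by nlinarith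
    have hn1 : (0 : ℝ) ≤ #{u | g u = 1} := by positivity
    have hn2 : (0 : ℝ) ≤ #{u | g u = -1} := by positivity
    have hn3 : (0 : ℝ) ≤ #{u | g u = 0} := by positivity
    rw [abs_le]
    constructor <;> linarith

end Stepanov

section CharSum
variable {p : ℕ} [Fact p.Prime]

/-- Few elements have constant quadratic character along `⌊log₂ p⌋` given shifts. -/
theorem card_le_of_quadraticChar_const (hp2 : p ≠ 2) (D W : Finset (ZMod p))
    (hD : #D = Nat.log 2 p) (eps : ℤ) (heps : eps = 1 ∨ eps = -1)
    (h : ∀ u ∈ W, ∀ d ∈ D, quadraticChar (ZMod p) (u + d) = eps) :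
    (#W : ℝ) ≤ 23 * Nat.log 2 p * √p := by
  classical
  set k := Nat.log 2 p with hk
  have hp1 : (1 : ℝ) ≤ p := by exact_mod_cast (Fact.out : p.Prime).one_lt.le
  have hs1 : 1 ≤ √(p : ℝ) := by rw [Real.one_le_sqrt]; exact hp1
  have hps : √(p : ℝ) * √p = p := Real.mul_self_sqrt (by positivity)
  set χ := fun u : ZMod p => ((quadraticChar (ZMod p) u : ℤ) : ℝ) with hχ
  have hχv : ∀ u, -1 ≤ eps * χ u := by
    intro u
    have := quadraticChar_isQuadratic (ZMod p) u
    rcases heps with rfl | rfl <;> rcases this with h | h | h <;> simp only [hχ, h] <;> norm_num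
  have hlow : (#W : ℝ) * 2 ^ k ≤ ∑ u : ZMod p, ∏ d ∈ D, (1 + eps * χ (u + d)) := by
    calc (#W : ℝ) * 2 ^ k = ∑ u ∈ W, ∏ d ∈ D, (1 + eps * χ (u + d)) := by
          rw [Finset.card_eq_sum_ones, Nat.cast_sum, Finset.sum_mul]
          refine Finset.sum_congr rfl fun u hu => ?_
          rw [Finset.prod_congr rfl (g := fun _ => (2 : ℝ))]
          · simp [hD]
          · intro d hd
            simp only [hχ, h u hu d hd]
            rcases heps with rfl | rfl <;> norm_num
      _ ≤ _ := Finset.sum_le_sum_of_subset_of_nonneg (Finset.subset_univ _) fun u _ _ =>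
          Finset.prod_nonneg fun d _ => by linarith [hχv (u + d)]
  have hexp : ∑ u : ZMod p, ∏ d ∈ D, (1 + eps * χ (u + d)) =
      ∑ I ∈ D.powerset, (eps : ℝ) ^ #I * ((∑ u : ZMod p, ∏ d ∈ I,
        quadraticChar (ZMod p) (u + d) : ℤ) : ℝ) := by
    simp_rw [Finset.prod_one_add]
    rw [Finset.sum_comm]
    refine Finset.sum_congr rfl fun I _ => ?_
    push_cast
    rw [Finset.mul_sum]
    refine Finset.sum_congr rfl fun u _ => ?_
    rw [Finset.prod_mul_distrib, Finset.prod_const]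
  have hbound : ∀ I ∈ D.powerset, (eps : ℝ) ^ #I * ((∑ u : ZMod p, ∏ d ∈ I,
        quadraticChar (ZMod p) (u + d) : ℤ) : ℝ) ≤ (if I = ∅ then (p : ℝ) else 0) +
          21 * k * √p := by
    intro I hI
    by_cases hI0 : I = ∅
    · subst hI0
      simp only [Finset.card_empty, pow_zero, Finset.prod_empty, Finset.sum_const, Finset.card_univ,
        ZMod.card, if_true, one_mul, mul_one, Int.cast_natCast, nsmul_eq_mul,
        le_add_iff_nonneg_right]
      positivity
    · have h1 := abs_sum_prod_quadraticChar_le hp2 I (Finset.nonempty_iff_ne_empty.2 hI0)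
      rw [if_neg hI0, zero_add]
      refine (le_abs_self _).trans ?_
      rw [abs_mul, abs_pow]
      have h2 : |(eps : ℝ)| = 1 := by rcases heps with rfl | rfl <;> simp
      rw [h2, one_pow, one_mul]
      refine h1.trans ?_
      have h3 : (#I : ℝ) ≤ k := by
        rw [← hD]; exact_mod_cast Finset.card_le_card (Finset.mem_powerset.1 hI)
      gcongr
  have hup := hlow.trans (hexp.le.trans (Finset.sum_le_sum hbound))
  rw [Finset.sum_add_distrib, Finset.sum_ite_eq' D.powerset ∅ (fun _ => (p : ℝ)),
    if_pos (Finset.empty_mem_powerset D), Finset.sum_const, Finset.card_powerset, hD,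
    nsmul_eq_mul] at hup
  push_cast at hup
  have h2k : (p : ℝ) < 2 ^ k * 2 := by
    have := Nat.lt_pow_succ_log_self (b := 2) (by norm_num) p
    rw [pow_succ] at this
    exact_mod_cast this
  have hk1 : (1 : ℝ) ≤ k := by
    have : 0 < k := Nat.log_pos (by norm_num) (Fact.out : p.Prime).two_le
    exact_mod_cast this
  have h2p : (0 : ℝ) < 2 ^ k := by positivity
  have hks : 2 ≤ 2 * (k * √(p : ℝ)) := by nlinarith
  refine le_of_mul_le_mul_right ?_ h2p
  nlinarith

end CharSum

section AlmostPeriodicity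
variable {G : Type*} [AddCommGroup G] [DecidableEq G]

/-- Indicator of `x + b ∈ A + A`. -/
def shiftInd (A : Finset G) (x b : G) : ℝ := if x + b ∈ A + A then 1 else 0

/-- The density of `a ∈ A` with `x + a ∈ A + A`. -/
noncomputable def shiftDensity (A : Finset G) (x : G) : ℝ := (∑ a ∈ A, shiftInd A x a) / #A

/-- The number of `i` with `x + a i ∈ A + A`. -/
def shiftCount (A : Finset G) {m : ℕ} (a : Fin m → G) (x : G) : ℝ := ∑ i, shiftInd A x (a i)

theorem shiftInd_nonneg (A : Finset G) (x b : G) : 0 ≤ shiftInd A x b := by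
  unfold shiftInd; split_ifs <;> norm_num

theorem shiftInd_le_one (A : Finset G) (x b : G) : shiftInd A x b ≤ 1 := by
  unfold shiftInd; split_ifs <;> norm_num

theorem shiftDensity_mem (A : Finset G) (x : G) :
    0 ≤ shiftDensity A x ∧ shiftDensity A x ≤ 1 := by
  refine ⟨div_nonneg (Finset.sum_nonneg fun a _ => shiftInd_nonneg A x a) (by positivity), ?_⟩
  refine div_le_one_of_le₀ ?_ (by positivity)
  calc ∑ a ∈ A, shiftInd A x a ≤ ∑ a ∈ A, (1 : ℝ) :=
        Finset.sum_le_sum fun a _ => shiftInd_le_one A x a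
    _ = _ := by simp

theorem sum_exp_shiftInd_le {A : Finset G} (hA : A.Nonempty) (x : G) (s : ℝ) (hs : |s| ≤ 1) :
    ∑ a ∈ A, Real.exp (s * (shiftInd A x a - shiftDensity A x)) ≤ #A * Real.exp (s ^ 2) := by
  have hn : (#A : ℝ) ≠ 0 := by exact_mod_cast hA.card_pos.ne'
  have hd := shiftDensity_mem A x
  have h1 : ∀ a ∈ A, Real.exp (s * (shiftInd A x a - shiftDensity A x)) ≤
      1 + s * (shiftInd A x a - shiftDensity A x) + s ^ 2 := by
    intro a _
    have hb : |shiftInd A x a - shiftDensity A x| ≤ 1 := by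
      rw [abs_le]
      constructor <;> linarith [shiftInd_nonneg A x a, shiftInd_le_one A x a, hd.1, hd.2]
    have hle : |s * (shiftInd A x a - shiftDensity A x)| ≤ |s| := by
      rw [abs_mul]; nlinarith [abs_nonneg s]
    have h2 := (abs_le.1 (Real.abs_exp_sub_one_sub_id_le (hle.trans hs))).2
    have h3 : (s * (shiftInd A x a - shiftDensity A x)) ^ 2 ≤ s ^ 2 := sq_le_sq.2 hle
    linarith
  have h4 : ∑ a ∈ A, (shiftInd A x a - shiftDensity A x) = 0 := by
    rw [Finset.sum_sub_distrib, Finset.sum_const, nsmul_eq_mul, shiftDensity]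
    field_simp
    ring
  calc _ ≤ ∑ a ∈ A, (1 + s * (shiftInd A x a - shiftDensity A x) + s ^ 2) :=
        Finset.sum_le_sum h1
    _ = #A * (s ^ 2 + 1) := by
        rw [Finset.sum_add_distrib, Finset.sum_add_distrib, ← Finset.mul_sum, h4]
        simp; ring
    _ ≤ _ := by gcongr; exact Real.add_one_le_exp _

theorem sum_exp_shiftCount_le {A : Finset G} (hA : A.Nonempty) (m : ℕ) (x : G) (s : ℝ)
    (hs : |s| ≤ 1) :
    ∑ a ∈ Fintype.piFinset fun _ : Fin m => A,
      Real.exp (s * (shiftCount A a x - m * shiftDensity A x)) ≤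
        #A ^ m * Real.exp (s ^ 2 * m) := by
  have h1 : ∀ a : Fin m → G, Real.exp (s * (shiftCount A a x - m * shiftDensity A x)) =
      ∏ i, Real.exp (s * (shiftInd A x (a i) - shiftDensity A x)) := by
    intro a
    rw [← Real.exp_sum, ← Finset.mul_sum, Finset.sum_sub_distrib]
    simp [shiftCount]
  simp_rw [h1]
  rw [← Finset.prod_univ_sum (fun _ : Fin m => A)
    (fun _ b => Real.exp (s * (shiftInd A x b - shiftDensity A x)))]
  rw [Finset.prod_const, Finset.card_univ, Fintype.card_fin]
  calc _ ≤ (#A * Real.exp (s ^ 2)) ^ m := by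
        gcongr
        exact sum_exp_shiftInd_le hA x s hs
    _ = _ := by rw [mul_pow, ← Real.exp_nat_mul]; ring_nf

/-- Tuples whose empirical counts approximate the density well. -/
noncomputable def goodTuples (A : Finset G) (m : ℕ) (s : ℝ) : Finset (Fin m → G) :=
  (Fintype.piFinset fun _ : Fin m => A).filter fun a =>
    ∑ y ∈ A + A - A, Real.exp (s * |shiftCount A a y - m * shiftDensity A y|) ≤
      4 * #(A + A - A) * Real.exp (s ^ 2 * m)

theorem card_goodTuples {A : Finset G} (hA : A.Nonempty) (m : ℕ) (s : ℝ) (hs0 : 0 ≤ s)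
    (hs : s ≤ 1) : (#A : ℝ) ^ m ≤ 2 * #(goodTuples A m s) := by
  classical
  set X := A + A - A with hX
  have hXne : X.Nonempty := (hA.add hA).sub hA
  set P := Fintype.piFinset fun _ : Fin m => A with hP
  have hPc : (#P : ℝ) = #A ^ m := by rw [hP]; simp
  set w : (Fin m → G) → ℝ := fun a =>
    ∑ y ∈ X, Real.exp (s * |shiftCount A a y - m * shiftDensity A y|) with hw
  set B : ℝ := 4 * #X * Real.exp (s ^ 2 * m) with hB
  have hBpos : 0 < B := by
    have : (0 : ℝ) < #X := by exact_mod_cast hXne.card_pos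
    positivity
  have hgood : goodTuples A m s = P.filter fun a => w a ≤ B := rfl
  have htot : ∑ a ∈ P, w a ≤ #A ^ m * (B / 2) := by
    rw [hw, Finset.sum_comm]
    have : ∀ y ∈ X, ∑ a ∈ P, Real.exp (s * |shiftCount A a y - m * shiftDensity A y|) ≤
        2 * (#A ^ m * Real.exp (s ^ 2 * m)) := by
      intro y _
      have e1 := sum_exp_shiftCount_le hA m y s (by rwa [abs_of_nonneg hs0])
      have e2 := sum_exp_shiftCount_le hA m y (-s) (by rwa [abs_neg, abs_of_nonneg hs0])
      rw [neg_sq] at e2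
      calc _ ≤ ∑ a ∈ P, (Real.exp (s * (shiftCount A a y - m * shiftDensity A y)) +
            Real.exp (-s * (shiftCount A a y - m * shiftDensity A y))) := by
            refine Finset.sum_le_sum fun a _ => ?_
            rcases abs_choice (shiftCount A a y - m * shiftDensity A y) with h | h <;> rw [h]
            · linarith [Real.exp_pos (-s * (shiftCount A a y - m * shiftDensity A y))]
            · rw [mul_neg, ← neg_mul]
              linarith [Real.exp_pos (s * (shiftCount A a y - m * shiftDensity A y))]
        _ ≤ _ := by rw [Finset.sum_add_distrib]; linarith
    refine (Finset.sum_le_sum this).trans (le_of_eq ?_)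
    rw [Finset.sum_const, nsmul_eq_mul, hB]
    ring
  have hbad : (#(P.filter fun a => ¬ w a ≤ B) : ℝ) * B ≤ #A ^ m * (B / 2) := by
    refine le_trans ?_ htot
    calc _ = ∑ a ∈ P.filter (fun a => ¬ w a ≤ B), B := by simp
      _ ≤ ∑ a ∈ P.filter (fun a => ¬ w a ≤ B), w a :=
          Finset.sum_le_sum fun a ha => (not_le.1 (Finset.mem_filter.1 ha).2).le
      _ ≤ _ := Finset.sum_le_sum_of_subset_of_nonneg (Finset.filter_subset _ _)
          fun a _ _ => Finset.sum_nonneg fun y _ => (Real.exp_pos _).le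
  have hsplit : (#(P.filter fun a => w a ≤ B) : ℝ) + #(P.filter fun a => ¬ w a ≤ B) = #A ^ m := by
    rw [← hPc]
    exact_mod_cast Finset.card_filter_add_card_filter_not (s := P) (fun a => w a ≤ B)
  have : (#(P.filter fun a => ¬ w a ≤ B) : ℝ) ≤ #A ^ m / 2 := by
    refine le_of_mul_le_mul_right (hbad.trans (le_of_eq ?_)) hBpos
    ring
  rw [hgood]
  linarith

theorem shiftInd_eq_zero {A : Finset G} {x b : G} (hb : b ∈ A) (hx : x ∉ A + A - A) :
    shiftInd A x b = 0 := by
  unfold shiftInd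
  rw [if_neg]
  intro h
  exact hx (by simpa using Finset.sub_mem_sub h hb)

/-- Pigeonhole: many translates of one tuple are good. -/
theorem exists_translates_good {A : Finset G} (hA : A.Nonempty) {K : ℝ}
    (hK : (#(A + A) : ℝ) ≤ K * #A) (m : ℕ) (s : ℝ) (hs0 : 0 ≤ s) (hs : s ≤ 1) :
    ∃ z : Fin m → G, ∃ T ⊆ A, (#A : ℝ) ≤ #T * (2 * K ^ m) ∧
      ∀ t ∈ T, (fun i => z i - t) ∈ goodTuples A m s := by
  classical
  have hn : (0 : ℝ) < #A := by exact_mod_cast hA.card_pos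
  set g := goodTuples A m s
  set Q := Fintype.piFinset fun _ : Fin m => A + A with hQ
  have hmaps : ∀ x ∈ g ×ˢ A, (fun i => x.1 i + x.2) ∈ Q := by
    intro x hx
    rw [Finset.mem_product] at hx
    rw [hQ, Fintype.mem_piFinset]
    intro i
    exact Finset.add_mem_add (Fintype.mem_piFinset.1 (Finset.mem_filter.1 hx.1).1 i) hx.2
  have hQc : (#Q : ℝ) = (#(A + A) : ℝ) ^ m := by rw [hQ]; simp
  have hQpos : (0 : ℝ) < #Q := by
    rw [hQc]; have := (hA.add hA).card_pos; positivity
  have hcg := card_goodTuples hA m s hs0 hs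
  obtain ⟨z, hz, hzc⟩ := Finset.exists_le_card_fiber_of_nsmul_le_card_of_maps_to (M := ℝ) hmaps
    (Finset.card_pos.1 (by exact_mod_cast hQpos)) (b := (#(g ×ˢ A) : ℝ) / #Q)
    (by rw [nsmul_eq_mul]; exact (mul_div_cancel₀ _ hQpos.ne').le)
  refine ⟨z, A.filter fun t => (fun i => z i - t) ∈ g, Finset.filter_subset _ _, ?_,
    fun t ht => (Finset.mem_filter.1 ht).2⟩
  have hinj : #((g ×ˢ A).filter fun x => (fun i => x.1 i + x.2) = z) ≤
      #(A.filter fun t => (fun i => z i - t) ∈ g) := by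
    refine Finset.card_le_card_of_injOn Prod.snd ?_ ?_
    · intro x hx
      simp only [Finset.coe_filter, Finset.mem_product, Set.mem_ofPred_eq] at hx
      simp only [Finset.coe_filter, Set.mem_ofPred_eq]
      refine ⟨hx.1.2, ?_⟩
      rw [← hx.2]
      simpa using hx.1.1
    · intro x hx y hy hxy
      simp only [Finset.coe_filter, Finset.mem_product, Set.mem_ofPred_eq] at hx hy
      refine Prod.ext ?_ hxy
      funext i
      have h1 := congrFun (hx.2.trans hy.2.symm) i
      simp only [hxy] at h1
      exact add_right_cancel h1
  have h1 : (#(g ×ˢ A) : ℝ) / #Q ≤ #(A.filter fun t => (fun i => z i - t) ∈ g) :=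
    hzc.trans (by exact_mod_cast hinj)
  rw [div_le_iff₀ hQpos, hQc, Finset.card_product] at h1
  push_cast at h1
  have hAm : (0 : ℝ) < #A ^ m := by positivity
  have h2 : (#(A + A) : ℝ) ^ m ≤ K ^ m * #A ^ m := by
    rw [← mul_pow]; gcongr
  set T := A.filter fun t => (fun i => z i - t) ∈ g
  refine le_of_mul_le_mul_left ?_ hAm
  calc (#A : ℝ) ^ m * #A ≤ 2 * #g * #A := by gcongr
    _ = 2 * (#g * #A) := by ring
    _ ≤ 2 * (#T * (K ^ m * #A ^ m)) := by
        refine mul_le_mul_of_nonneg_left (h1.trans ?_) (by norm_num)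
        gcongr
    _ = _ := by ring

theorem card_add_sub_le {A : Finset G} (hA : A.Nonempty) {K : ℝ}
    (hK : (#(A + A) : ℝ) ≤ K * #A) : (#(A + A - A) : ℝ) ≤ K ^ 3 * #A := by
  have hn : (0 : ℝ) < #A := by exact_mod_cast hA.card_pos
  have h := Finset.pluennecke_ruzsa_inequality_nsmul_sub_nsmul_add hA A 2 1
  have h1 : (#(2 • A - 1 • A) : ℝ) ≤ ((#(A + A) : ℝ) / #A) ^ (2 + 1) * #A := by
    have h' := (NNRat.cast_le (K := ℝ)).2 h
    push_cast at h'
    exact h'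
  rw [two_nsmul, one_nsmul] at h1
  refine h1.trans ?_
  have : (#(A + A) : ℝ) / #A ≤ K := by rwa [div_le_iff₀ hn]
  gcongr

theorem card_sub_le {A : Finset G} (hA : A.Nonempty) {K : ℝ}
    (hK : (#(A + A) : ℝ) ≤ K * #A) : (#(A - A) : ℝ) ≤ K ^ 2 * #A := by
  have hn : (0 : ℝ) < #A := by exact_mod_cast hA.card_pos
  have h := Finset.pluennecke_ruzsa_inequality_nsmul_sub_nsmul_add hA A 1 1
  have h1 : (#(1 • A - 1 • A) : ℝ) ≤ ((#(A + A) : ℝ) / #A) ^ (1 + 1) * #A := by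
    have h' := (NNRat.cast_le (K := ℝ)).2 h
    push_cast at h'
    exact h'
  rw [one_nsmul] at h1
  refine h1.trans ?_
  have : (#(A + A) : ℝ) / #A ≤ K := by rwa [div_le_iff₀ hn]
  gcongr

theorem sum_shift_error_le {A : Finset G} (hA : A.Nonempty) {K : ℝ} (hK1 : 1 ≤ K)
    (hK : (#(A + A) : ℝ) ≤ K * #A) (m l : ℕ) (hl : 1 ≤ l)
    (hm : 64 * (l : ℝ) ^ 2 * Real.log (4 * K ^ 3) ≤ m) (a : Fin m → G)
    (ha : a ∈ goodTuples A m (1 / (8 * l))) (w : G) :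
    ∑ x ∈ A, |shiftCount A a (x + w) / m - shiftDensity A (x + w)| ≤ #A / (4 * l) := by
  classical
  have hl' : (1 : ℝ) ≤ l := by exact_mod_cast hl
  have hK3 : 1 ≤ K ^ 3 := one_le_pow₀ hK1
  have hlog4 : 1 ≤ Real.log (4 * K ^ 3) := by
    rw [Real.le_log_iff_exp_le (by positivity)]
    linarith [Real.exp_one_lt_d9]
  have hmpos : (0 : ℝ) < m := by
    refine lt_of_lt_of_le ?_ hm
    positivity
  have hn : (0 : ℝ) < #A := by exact_mod_cast hA.card_pos
  set s : ℝ := 1 / (8 * l) with hs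
  have hspos : 0 < s := by positivity
  set X := A + A - A with hX
  set e : G → ℝ := fun y => |shiftCount A a y / m - shiftDensity A y| with he
  have hame : ∀ i, a i ∈ A := Fintype.mem_piFinset.1 (Finset.mem_filter.1 ha).1
  have he0 : ∀ y ∉ X, e y = 0 := by
    intro y hy
    simp only [he, shiftCount, shiftDensity]
    rw [Finset.sum_eq_zero fun i _ => shiftInd_eq_zero (hame i) hy,
      Finset.sum_eq_zero fun b hb => shiftInd_eq_zero hb hy]
    simp
  have hsum : ∑ y ∈ X, Real.exp (s * m * e y) ≤ 4 * #X * Real.exp (s ^ 2 * m) := by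
    convert (Finset.mem_filter.1 ha).2 using 3 with y hy
    simp only [he]
    rw [mul_assoc]
    congr 1
    rw [← abs_of_pos hmpos, ← abs_mul, abs_of_pos hmpos]
    congr 1
    field_simp
  set Q : ℝ := 4 * K ^ 3 * Real.exp (s ^ 2 * m) with hQ
  have hQpos : 0 < Q := by positivity
  have hlogQ : Real.log Q = Real.log (4 * K ^ 3) + s ^ 2 * m := by
    rw [hQ, Real.log_mul (by positivity) (Real.exp_pos _).ne', Real.log_exp]
  have hpt : ∀ u : ℝ, u ≤ Real.log Q - 1 + Real.exp u / Q := by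
    intro u
    have := Real.add_one_le_exp (u - Real.log Q)
    rw [Real.exp_sub, Real.exp_log hQpos] at this
    linarith
  have hXc : (#X : ℝ) ≤ K ^ 3 * #A := card_add_sub_le hA hK
  have hmain : s * m * ∑ x ∈ A, e (x + w) ≤ #A * Real.log Q := by
    rw [Finset.mul_sum]
    have hstep : ∀ x ∈ A, s * m * e (x + w) ≤ (Real.log Q - 1) +
        (if x + w ∈ X then Real.exp (s * m * e (x + w)) / Q else 0) := by
      intro x _
      split_ifs with hx
      · exact hpt _
      · rw [he0 _ hx]
        have : 0 ≤ s ^ 2 * m := by positivity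
        linarith
    refine (Finset.sum_le_sum hstep).trans ?_
    rw [Finset.sum_add_distrib, Finset.sum_const, nsmul_eq_mul]
    have h2 : ∑ x ∈ A, (if x + w ∈ X then Real.exp (s * m * e (x + w)) / Q else 0) ≤ #A := by
      calc _ = ∑ y ∈ A.image (· + w), if y ∈ X then Real.exp (s * m * e y) / Q else 0 := by
            rw [Finset.sum_image fun a _ b _ h => add_right_cancel h]
        _ = ∑ y ∈ (A.image (· + w)).filter (· ∈ X), Real.exp (s * m * e y) / Q := by
            rw [Finset.sum_filter]
        _ ≤ ∑ y ∈ X, Real.exp (s * m * e y) / Q := by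
            refine Finset.sum_le_sum_of_subset_of_nonneg ?_ fun y _ _ => by positivity
            intro y hy; exact (Finset.mem_filter.1 hy).2
        _ = (∑ y ∈ X, Real.exp (s * m * e y)) / Q := by rw [Finset.sum_div]
        _ ≤ _ := by
            rw [div_le_iff₀ hQpos]
            refine hsum.trans ?_
            rw [hQ]
            calc _ ≤ 4 * (K ^ 3 * #A) * Real.exp (s ^ 2 * m) := by gcongr
              _ = _ := by ring
    linarith
  have hlQ : Real.log Q ≤ s * m / (4 * l) := by
    rw [hlogQ, hs]
    have : Real.log (4 * K ^ 3) ≤ m / (64 * l ^ 2) := by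
      rw [le_div_iff₀ (by positivity)]; linarith
    refine (add_le_add_left this _).trans (le_of_eq ?_)
    field_simp
    norm_num
  have hsm : 0 < s * m := by positivity
  refine le_of_mul_le_mul_left (hmain.trans ?_) hsm
  calc (#A : ℝ) * Real.log Q ≤ #A * (s * m / (4 * l)) := by gcongr
    _ = _ := by ring

/-- Almost periods: sums of differences of elements of a large set lie in `2A - 2A`. -/
theorem exists_almost_periods {A : Finset G} (hA : A.Nonempty) {K : ℝ} (hK1 : 1 ≤ K)
    (hK : (#(A + A) : ℝ) ≤ K * #A) (m l : ℕ) (hl : 1 ≤ l)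
    (hm : 64 * (l : ℝ) ^ 2 * Real.log (4 * K ^ 3) ≤ m) :
    ∃ T ⊆ A, (#A : ℝ) ≤ #T * (2 * K ^ m) ∧ ∀ t t' : ℕ → G, (∀ i < l, t i ∈ T) →
      (∀ i < l, t' i ∈ T) → ∑ i ∈ range l, (t' i - t i) ∈ A + A - A - A := by
  classical
  have hl' : (1 : ℝ) ≤ l := by exact_mod_cast hl
  have hn : (0 : ℝ) < #A := by exact_mod_cast hA.card_pos
  obtain ⟨z, T, hTA, hTc, hT⟩ := exists_translates_good hA hK m (1 / (8 * l)) (by positivity)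
    (by rw [div_le_one (by positivity)]; linarith)
  refine ⟨T, hTA, hTc, fun t t' ht ht' => ?_⟩
  have hshift : ∀ u y : G, shiftCount A (fun i => z i - u) y = shiftCount A z (y - u) := by
    intro u y
    unfold shiftCount shiftInd
    refine Finset.sum_congr rfl fun i _ => ?_
    rw [show y + (z i - u) = y - u + z i by abel]
  have hstep : ∀ u ∈ T, ∀ u' ∈ T, ∀ w, ∑ x ∈ A, |shiftDensity A (x + w) -
      shiftDensity A (x + (w + (u' - u)))| ≤ #A / (2 * l) := by
    intro u hu u' hu' w
    have h1 := sum_shift_error_le hA hK1 hK m l hl hm _ (hT u hu) w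
    have h2 := sum_shift_error_le hA hK1 hK m l hl hm _ (hT u' hu') (w + (u' - u))
    calc _ ≤ ∑ x ∈ A, (|shiftCount A (fun i => z i - u) (x + w) / m - shiftDensity A (x + w)| +
          |shiftCount A (fun i => z i - u') (x + (w + (u' - u))) / m -
            shiftDensity A (x + (w + (u' - u)))|) := by
          refine Finset.sum_le_sum fun x _ => ?_
          rw [hshift, hshift, show x + (w + (u' - u)) - u' = x + w - u by abel]
          rw [abs_sub_comm (shiftCount A z (x + w - u) / m) (shiftDensity A (x + w))]
          exact abs_sub_le _ _ _
      _ ≤ #A / (4 * l) + #A / (4 * l) := by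
          rw [Finset.sum_add_distrib]; exact add_le_add h1 h2
      _ = _ := by field_simp; norm_num
  have hind : ∀ k ≤ l, ∑ x ∈ A, |shiftDensity A x -
      shiftDensity A (x + ∑ i ∈ range k, (t' i - t i))| ≤ k * (#A / (2 * l)) := by
    intro k
    induction k with
    | zero => intro _; simp
    | succ k ih =>
      intro hk
      have h1 := ih (by omega)
      have h2 := hstep (t k) (ht k (by omega)) (t' k) (ht' k (by omega))
        (∑ i ∈ range k, (t' i - t i))
      rw [Finset.sum_range_succ]
      calc _ ≤ ∑ x ∈ A, (|shiftDensity A x -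
            shiftDensity A (x + ∑ i ∈ range k, (t' i - t i))| +
            |shiftDensity A (x + ∑ i ∈ range k, (t' i - t i)) -
              shiftDensity A (x + (∑ i ∈ range k, (t' i - t i) + (t' k - t k)))|) :=
            Finset.sum_le_sum fun x _ => abs_sub_le _ _ _
        _ ≤ k * (#A / (2 * l)) + #A / (2 * l) := by
            rw [Finset.sum_add_distrib]; exact add_le_add h1 h2
        _ = _ := by push_cast; ring
  set v := ∑ i ∈ range l, (t' i - t i) with hv
  have hfin := hind l le_rfl
  have hone : ∀ x ∈ A, shiftDensity A x = 1 := by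
    intro x hx
    unfold shiftDensity
    have h1 : ∀ a ∈ A, shiftInd A x a = 1 := fun a ha => if_pos (Finset.add_mem_add hx ha)
    rw [Finset.sum_congr rfl h1]
    simp [hn.ne']
  by_contra hcon
  have hzero : ∀ x ∈ A, shiftDensity A (x + v) = 0 := by
    intro x hx
    unfold shiftDensity
    rw [Finset.sum_eq_zero, zero_div]
    intro a ha
    apply shiftInd_eq_zero ha
    intro h
    apply hcon
    simpa using Finset.sub_mem_sub h hx
  rw [Finset.sum_congr rfl (g := fun _ => (1 : ℝ)) (fun x hx => by
    rw [hone x hx, hzero x hx]; norm_num), Finset.sum_const, nsmul_eq_mul, mul_one] at hfin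
  have : (l : ℝ) * (#A / (2 * l)) = #A / 2 := by field_simp
  rw [this] at hfin
  linarith

end AlmostPeriodicity

section Progressions
variable {p : ℕ} [Fact p.Prime]

theorem card_dilate_sub_le (hp2 : p ≠ 2) {A : Finset (ZMod p)} (hA : A.Nonempty) {K : ℝ}
    (hK1 : 1 ≤ K) (hK : (#(A + A) : ℝ) ≤ K * #A) (i : ℕ) :
    (#(A.image (fun x => (2 : ZMod p) ^ i * x) - A) : ℝ) ≤ K ^ (3 * i + 2) * #A := by
  have hn : (0 : ℝ) < #A := by exact_mod_cast hA.card_pos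
  have h2 : (2 : ZMod p) ≠ 0 := by
    have : ((2 : ℕ) : ZMod p) ≠ 0 := by
      rw [Ne, ZMod.natCast_eq_zero_iff]
      intro h
      exact hp2 ((Nat.prime_dvd_prime_iff_eq Fact.out Nat.prime_two).1 h)
    exact_mod_cast this
  have hinj : ∀ i, Function.Injective fun x : ZMod p => (2 : ZMod p) ^ i * x := fun i =>
    mul_right_injective₀ (pow_ne_zero i h2)
  induction i with
  | zero => simpa using card_sub_le hA hK
  | succ i ih =>
    set D : ℕ → Finset (ZMod p) := fun i => A.image fun x => (2 : ZMod p) ^ i * x with hD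
    have hr := Finset.ruzsa_triangle_inequality_sub_sub_sub (D (i + 1)) (D i) A
    have hDc : #(D i) = #A := Finset.card_image_of_injective _ (hinj i)
    have hsub : #(D (i + 1) - D i) ≤ #(A + A - A) := by
      have : D (i + 1) - D i ⊆ (A + A - A).image fun x => (2 : ZMod p) ^ i * x := by
        intro x hx
        obtain ⟨a, ha, b, hb, rfl⟩ := Finset.mem_sub.1 hx
        obtain ⟨a, ha', rfl⟩ := Finset.mem_image.1 ha
        obtain ⟨b, hb', rfl⟩ := Finset.mem_image.1 hb
        refine Finset.mem_image.2 ⟨a + a - b,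
          Finset.sub_mem_sub (Finset.add_mem_add ha' ha') hb', ?_⟩
        ring
      exact (Finset.card_le_card this).trans Finset.card_image_le
    have hneg : #(A - D i) = #(D i - A) := by
      rw [← Finset.card_neg, neg_sub]
    rw [hDc, hneg] at hr
    have hr' : (#(D (i + 1) - A) : ℝ) * #A ≤ #(D (i + 1) - D i) * #(D i - A) := by
      exact_mod_cast hr
    have hs' : (#(D (i + 1) - D i) : ℝ) ≤ K ^ 3 * #A :=
      le_trans (by exact_mod_cast hsub) (card_add_sub_le hA hK)
    refine le_of_mul_le_mul_right (hr'.trans ?_) hn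
    calc _ ≤ (K ^ 3 * #A) * (K ^ (3 * i + 2) * #A) := by gcongr
      _ = _ := by ring

/-- A large set `Y` such that all short progressions from `0` with difference in `Y` lie in
`2A - 2A`. -/
theorem exists_progression_differences (hp2 : p ≠ 2) {A : Finset (ZMod p)} (hA : A.Nonempty)
    {K : ℝ} (hK1 : 1 ≤ K) (hK : (#(A + A) : ℝ) ≤ K * #A) (m l : ℕ) (hl : 1 ≤ l)
    (hm : 64 * (l : ℝ) ^ 2 * Real.log (4 * K ^ 3) ≤ m) :
    ∃ Y : Finset (ZMod p), #Y ≤ #A ∧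
      (#A : ℝ) ≤ #Y * ((2 * K ^ m) ^ (l + 1) * K ^ (3 * l ^ 2)) ∧
      ∀ y ∈ Y, ∀ j : ℕ, j < 2 ^ l → (j : ZMod p) * y ∈ A + A - A - A := by
  classical
  have hn : (0 : ℝ) < #A := by exact_mod_cast hA.card_pos
  obtain ⟨T, hTA, hTc, hT⟩ := exists_almost_periods hA hK1 hK m l hl hm
  have hTpos : (0 : ℝ) < #T := by
    by_contra hcon
    have : (#T : ℝ) = 0 := le_antisymm (not_lt.1 hcon) (by positivity)
    rw [this, zero_mul] at hTc
    linarith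
  have hTne : T.Nonempty := Finset.card_pos.1 (by exact_mod_cast hTpos)
  set D : Fin l → Finset (ZMod p) := fun i => A.image (fun x => (2 : ZMod p) ^ (i : ℕ) * x) - A
  set Q := Fintype.piFinset D with hQ
  set P := T ×ˢ (Fintype.piFinset fun _ : Fin l => T) with hP
  set φ : ZMod p × (Fin l → ZMod p) → (Fin l → ZMod p) :=
    fun x i => (2 : ZMod p) ^ (i : ℕ) * x.1 - x.2 i with hφ
  have hmaps : ∀ x ∈ P, φ x ∈ Q := by
    intro x hx
    rw [hP, Finset.mem_product] at hx
    rw [hQ, Fintype.mem_piFinset]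
    intro i
    exact Finset.sub_mem_sub (Finset.mem_image_of_mem _ (hTA hx.1))
      (hTA (Fintype.mem_piFinset.1 hx.2 i))
  have hPc : (#P : ℝ) = #T * #T ^ l := by rw [hP, Finset.card_product]; simp
  have hQne : Q.Nonempty := by
    obtain ⟨t, ht⟩ := hTne
    exact ⟨_, hmaps (t, fun _ => t) (by simp [hP, ht])⟩
  have hQpos : (0 : ℝ) < #Q := by exact_mod_cast hQne.card_pos
  have hQc : (#Q : ℝ) ≤ K ^ (3 * l ^ 2) * #A ^ l := by
    rw [hQ, Fintype.card_piFinset]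
    push_cast
    calc ∏ i, (#(D i) : ℝ) ≤ ∏ i : Fin l, K ^ (3 * l) * #A := by
          refine Finset.prod_le_prod (fun i _ => by positivity) fun i _ => ?_
          refine (card_dilate_sub_le hp2 hA hK1 hK i).trans ?_
          have := i.2
          gcongr
          omega
      _ = _ := by
          rw [Finset.prod_const, Finset.card_univ, Fintype.card_fin, mul_pow, ← pow_mul]
          ring_nf
  obtain ⟨z, hz, hzc⟩ := Finset.exists_le_card_fiber_of_nsmul_le_card_of_maps_to (M := ℝ) hmaps
    hQne (b := (#P : ℝ) / #Q) (by rw [nsmul_eq_mul]; exact (mul_div_cancel₀ _ hQpos.ne').le)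
  set Fb := P.filter fun x => φ x = z with hFb
  have hinj : Set.InjOn Prod.fst (Fb : Set (ZMod p × (Fin l → ZMod p))) := by
    intro x hx y hy hxy
    have hx2 := (Finset.mem_filter.1 hx).2
    have hy2 := (Finset.mem_filter.1 hy).2
    refine Prod.ext hxy ?_
    funext i
    have h1 := congrFun (hx2.trans hy2.symm) i
    simp only [hφ, hxy] at h1
    exact sub_right_injective h1
  have hPpos : (0 : ℝ) < #P := by rw [hPc]; positivity
  have hFpos : (0 : ℝ) < #Fb := lt_of_lt_of_le (by positivity) hzc
  obtain ⟨x0, hx0⟩ := Finset.card_pos.1 (by exact_mod_cast hFpos : 0 < #Fb)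
  set Y := (Fb.image Prod.fst).image fun t => t - x0.1 with hY
  have hYc : #Y = #Fb := by
    rw [hY, Finset.card_image_of_injective _ sub_left_injective, Finset.card_image_of_injOn hinj]
  refine ⟨Y, ?_, ?_, ?_⟩
  · rw [hY]
    refine Finset.card_image_le.trans (Finset.card_le_card fun t ht => ?_)
    obtain ⟨x, hx, rfl⟩ := Finset.mem_image.1 ht
    exact hTA (Finset.mem_product.1 (Finset.mem_filter.1 hx).1).1
  · rw [hYc]
    have h1 : (#T : ℝ) * #T ^ l ≤ #Fb * (K ^ (3 * l ^ 2) * #A ^ l) := by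
      rw [div_le_iff₀ hQpos, hPc] at hzc
      exact hzc.trans (by gcongr)
    have hAl : (0 : ℝ) < #A ^ l := by positivity
    refine le_of_mul_le_mul_left ?_ hAl
    calc (#A : ℝ) ^ l * #A = #A ^ (l + 1) := by ring
      _ ≤ (#T * (2 * K ^ m)) ^ (l + 1) := by gcongr
      _ = (#T * #T ^ l) * (2 * K ^ m) ^ (l + 1) := by rw [mul_pow]; ring
      _ ≤ (#Fb * (K ^ (3 * l ^ 2) * #A ^ l)) * (2 * K ^ m) ^ (l + 1) := by gcongr
      _ = _ := by ring
  · intro y hy j hj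
    obtain ⟨t, ht, rfl⟩ := Finset.mem_image.1 hy
    obtain ⟨x, hx, rfl⟩ := Finset.mem_image.1 ht
    have hxP := Finset.mem_product.1 (Finset.mem_filter.1 hx).1
    have hx0P := Finset.mem_product.1 (Finset.mem_filter.1 hx0).1
    have heq := (Finset.mem_filter.1 hx).2.trans (Finset.mem_filter.1 hx0).2.symm
    set u' : ℕ → ZMod p := fun i => if h : i < l then x.2 ⟨i, h⟩ else 0
    set u : ℕ → ZMod p := fun i => if h : i < l then
      (if j.testBit i then x0.2 ⟨i, h⟩ else x.2 ⟨i, h⟩) else 0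
    have hmem := hT u u' (by
      intro i hi
      simp only [u, dif_pos hi]
      split_ifs
      · exact Fintype.mem_piFinset.1 hx0P.2 _
      · exact Fintype.mem_piFinset.1 hxP.2 _) (by
      intro i hi
      simp only [u', dif_pos hi]
      exact Fintype.mem_piFinset.1 hxP.2 _)
    convert hmem using 1
    have hbits : (j : ZMod p) = ∑ i ∈ range l, (if j.testBit i then (2 : ZMod p) ^ i else 0) := by
      have h1 : j = ∑ i ∈ range l, (if j.testBit i then 2 ^ i else 0) := by
        rw [← Finset.sum_filter]
        conv_lhs => rw [← Finset.sum_toFinset_bitIndices_two_pow j]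
        refine Finset.sum_congr ?_ fun _ _ => rfl
        ext i
        rw [List.mem_toFinset, Nat.mem_bitIndices, Finset.mem_filter, Finset.mem_range]
        refine ⟨fun h => ⟨?_, h⟩, fun h => h.2⟩
        exact (Nat.pow_lt_pow_iff_right (by norm_num)).1 ((Nat.ge_two_pow_of_testBit h).trans_lt hj)
      conv_lhs => rw [h1]
      push_cast
      rfl
    rw [hbits, Finset.sum_mul]
    refine Finset.sum_congr rfl fun i hi => ?_
    have hil := Finset.mem_range.1 hi
    have h1 := congrFun heq ⟨i, hil⟩
    simp only [hφ] at h1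
    simp only [u, u', dif_pos hil]
    split_ifs
    · linear_combination h1
    · simp

end Progressions

section Lines
open MvPolynomial
variable {k : Type*} [Field k]

/-- Restriction of a polynomial in three variables to the line `P + Q * T`. -/
noncomputable def lineHom (P Q : Fin 3 → k) : MvPolynomial (Fin 3) k →ₐ[k] Polynomial k :=
  aeval fun i => Polynomial.C (P i) + Polynomial.C (Q i) * Polynomial.X

/-- Polynomials whose degree in each variable is less than the given bound. -/
noncomputable abbrev boxPoly (k : Type*) [Field k] (N : Fin 3 → ℕ) :
    Submodule k (MvPolynomial (Fin 3) k) :=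
  restrictSupport k {s | ∀ i, s i < N i}

/-- Exponents in a box. -/
noncomputable def boxEquiv (N : Fin 3 → ℕ) :
    {s : Fin 3 →₀ ℕ | ∀ i, s i < N i} ≃ ((i : Fin 3) → Fin (N i)) where
  toFun s i := ⟨s.1 i, s.2 i⟩
  invFun g := ⟨Finsupp.equivFunOnFinite.symm fun i => (g i : ℕ), fun i => by simp⟩
  left_inv s := by ext; simp
  right_inv g := by ext; simp

instance (N : Fin 3 → ℕ) : Finite {s : Fin 3 →₀ ℕ | ∀ i, s i < N i} :=
  Finite.of_equiv _ (boxEquiv N).symm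

instance (N : Fin 3 → ℕ) : Module.Finite k (boxPoly k N) :=
  Module.Finite.of_basis (basisRestrictSupport k {s : Fin 3 →₀ ℕ | ∀ i, s i < N i})

theorem finrank_boxPoly (N : Fin 3 → ℕ) : Module.finrank k (boxPoly k N) = ∏ i, N i := by
  rw [Module.finrank_eq_nat_card_basis
    (basisRestrictSupport k {s : Fin 3 →₀ ℕ | ∀ i, s i < N i}), Nat.card_congr (boxEquiv N)]
  simp

theorem mem_boxPoly_iff {N : Fin 3 → ℕ} {f : MvPolynomial (Fin 3) k} :
    f ∈ boxPoly k N ↔ ∀ m ∈ f.support, ∀ i, m i < N i := by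
  rw [mem_restrictSupport_iff]
  exact Iff.rfl

theorem mem_boxPoly_of_degreeOf_lt {N : Fin 3 → ℕ} {f : MvPolynomial (Fin 3) k}
    (h : ∀ i, degreeOf i f < N i) : f ∈ boxPoly k N :=
  mem_boxPoly_iff.2 fun m hm i =>
    (degreeOf_lt_iff (lt_of_le_of_lt (Nat.zero_le _) (h i))).1 (h i) m hm

theorem degreeOf_lt_of_mem_boxPoly {N : Fin 3 → ℕ} {f : MvPolynomial (Fin 3) k} (hf : f ≠ 0)
    (h : f ∈ boxPoly k N) (i : Fin 3) : degreeOf i f < N i := by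
  rw [mem_boxPoly_iff] at h
  obtain ⟨m, hm⟩ := support_nonempty.2 hf
  exact (degreeOf_lt_iff (lt_of_le_of_lt (Nat.zero_le _) (h m hm i))).2 fun m hm => h m hm i

theorem mul_mem_boxPoly {n d : Fin 3 → ℕ} {f u : MvPolynomial (Fin 3) k}
    (hf : ∀ i, degreeOf i f ≤ d i) (hu : u ∈ boxPoly k (fun i => n i - d i)) :
    f * u ∈ boxPoly k n := by
  by_cases hu0 : u = 0
  · simp [hu0]
  refine mem_boxPoly_of_degreeOf_lt fun i => ?_
  have h1 := degreeOf_lt_of_mem_boxPoly hu0 hu i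
  have h2 := degreeOf_mul_le i f u
  have := hf i
  omega

theorem lines_arith {L d n a b c : ℤ} (hL : 0 ≤ L) (hd : 0 ≤ d) (ha : 0 ≤ a) (hb : 0 ≤ b)
    (hc : 0 ≤ c) (had : a ≤ d) (hbd : b ≤ d) (hcd : c ≤ d) (hn : n = 2 * L + 2 * d)
    (h : 2 * ((n - a) * (n - b) * (n - c)) + L * (L + 2 * d + 1) ≤
      n ^ 3 + (n - 2 * a) * (n - 2 * b) * (n - 2 * c)) : L ≤ 12 * d ^ 2 := by
  have hn0 : 0 ≤ n := by omega
  have hab : n * (a * b) ≤ n * d ^ 2 := by rw [sq]; gcongr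
  have hac : n * (a * c) ≤ n * d ^ 2 := by rw [sq]; gcongr
  have hbc : n * (b * c) ≤ n * d ^ 2 := by rw [sq]; gcongr
  have habc : 0 ≤ a * b * c := by positivity
  have hkey : L * (L + 2 * d + 1) ≤ 6 * n * d ^ 2 := by linarith
  rw [hn] at hkey
  by_contra! hcon
  nlinarith

set_option maxHeartbeats 1000000 in
/-- A family of lines on which two coprime polynomials of the same multidegree vanish, any two
lines being separated by a linear form, has size at most quadratic in the degree. -/
theorem card_common_lines_le {ι : Type*} [DecidableEq ι] (L : Finset ι) (P Q : ι → Fin 3 → k)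
    (hQ : ∀ i ∈ L, Q i 0 ≠ 0) (form : ι → ι → MvPolynomial (Fin 3) k)
    (hform : ∀ i j v, degreeOf v (form i j) ≤ 1)
    (hform0 : ∀ i ∈ L, ∀ j ∈ L, i ≠ j → lineHom (P j) (Q j) (form i j) = 0)
    (hform1 : ∀ i ∈ L, ∀ j ∈ L, i ≠ j → lineHom (P i) (Q i) (form i j) ≠ 0)
    (f g : MvPolynomial (Fin 3) k) (hf : Prime f) (hfg : ¬ f ∣ g) (d : ℕ)
    (hdf : ∀ v, degreeOf v f ≤ d) (hdfg : ∀ v, degreeOf v g = degreeOf v f)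
    (hfL : ∀ i ∈ L, lineHom (P i) (Q i) f = 0) (hgL : ∀ i ∈ L, lineHom (P i) (Q i) g = 0) :
    #L ≤ 12 * d ^ 2 := by
  classical
  have hf0 : f ≠ 0 := hf.ne_zero
  have hg0 : g ≠ 0 := fun h => hfg (h ▸ dvd_zero f)
  set D : Fin 3 → ℕ := fun i => degreeOf i f with hD
  set n := 2 * #L + 2 * d with hn
  set N1 : Fin 3 → ℕ := fun i => n - D i with hN1
  set N2 : Fin 3 → ℕ := fun i => N1 i - D i with hN2
  set M := n - #L + 1 with hM
  let V := boxPoly k N1 × boxPoly k N1 × (L → Polynomial.degreeLT k M)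
  set H : ι → MvPolynomial (Fin 3) k := fun i => ∏ j ∈ L.erase i, form i j with hH
  let comb : (L → Polynomial.degreeLT k M) →ₗ[k] MvPolynomial (Fin 3) k :=
    ∑ i : L, LinearMap.mulRight k (H i) ∘ₗ
      (Polynomial.aeval (X 0 : MvPolynomial (Fin 3) k)).toLinearMap ∘ₗ
        (Polynomial.degreeLT k M).subtype ∘ₗ LinearMap.proj i
  have hcomb : ∀ c, comb c = ∑ i : L, Polynomial.aeval (X 0 : MvPolynomial (Fin 3) k)
      (c i : Polynomial k) * H i := by
    intro c
    simp [comb, LinearMap.sum_apply]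
  let Φ : V →ₗ[k] MvPolynomial (Fin 3) k :=
    (LinearMap.mulLeft k f ∘ₗ (boxPoly k N1).subtype ∘ₗ LinearMap.fst k _ _) +
    (LinearMap.mulLeft k g ∘ₗ (boxPoly k N1).subtype ∘ₗ LinearMap.fst k _ _ ∘ₗ
      LinearMap.snd k _ _) + comb ∘ₗ LinearMap.snd k _ _ ∘ₗ LinearMap.snd k _ _
  have hΦ : ∀ x : V, Φ x = f * (x.1 : MvPolynomial (Fin 3) k) +
      g * (x.2.1 : MvPolynomial (Fin 3) k) + comb x.2.2 := fun x => rfl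
  have hrange : LinearMap.range Φ ≤ boxPoly k fun _ => n := by
    rintro _ ⟨x, rfl⟩
    rw [hΦ]
    refine Submodule.add_mem _ (Submodule.add_mem _ ?_ ?_) ?_
    · exact mul_mem_boxPoly (d := D) (fun i => le_rfl) x.1.2
    · exact mul_mem_boxPoly (d := D) (fun i => (hdfg i).le) x.2.1.2
    · rw [hcomb]
      refine Submodule.sum_mem _ fun i _ => ?_
      refine mem_boxPoly_of_degreeOf_lt fun v => ?_
      have hL1 : 0 < #L := Finset.card_pos.2 ⟨i, i.2⟩
      have h1 : degreeOf v (H i) ≤ #L - 1 := by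
        refine (degreeOf_prod_le v _ _).trans ?_
        refine (Finset.sum_le_card_nsmul _ _ 1 fun j _ => hform _ _ _).trans ?_
        rw [Finset.card_erase_of_mem i.2, smul_eq_mul, mul_one]
      have h2 : degreeOf v (Polynomial.aeval (X 0 : MvPolynomial (Fin 3) k)
          (x.2.2 i : Polynomial k)) ≤ n - #L := by
        rw [Polynomial.aeval_eq_sum_range]
        refine (degreeOf_sum_le _ _ _).trans (Finset.sup_le fun j hj => ?_)
        rw [Algebra.smul_def, algebraMap_eq]
        refine (degreeOf_C_mul_le _ _ _).trans ((degreeOf_pow_le _ _ _).trans ?_)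
        have h3 : degreeOf v (X 0 : MvPolynomial (Fin 3) k) ≤ 1 := by
          rw [degreeOf_X]; split_ifs <;> simp
        have h4 : (x.2.2 i : Polynomial k).natDegree < M := by
          have := Polynomial.mem_degreeLT.1 (x.2.2 i).2
          by_cases h0 : (x.2.2 i : Polynomial k) = 0
          · rw [h0]; simp [hM]
          · exact (Polynomial.natDegree_lt_iff_degree_lt h0).2 this
        have h5 := Finset.mem_range.1 hj
        have h6 : j * degreeOf v (X 0 : MvPolynomial (Fin 3) k) ≤ j * 1 :=
          Nat.mul_le_mul_left _ h3
        omega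
      have := degreeOf_mul_le v (Polynomial.aeval (X 0 : MvPolynomial (Fin 3) k)
          (x.2.2 i : Polynomial k)) (H i)
      omega
  have hkerc : ∀ x ∈ LinearMap.ker Φ, x.2.2 = 0 := by
    intro x hx
    rw [LinearMap.mem_ker, hΦ, hcomb] at hx
    funext i
    have h1 := congrArg (lineHom (P i) (Q i)) hx
    rw [map_add, map_add, map_mul, map_mul, hfL i i.2, hgL i i.2, zero_mul, zero_mul, zero_add,
      zero_add, map_sum, map_zero, Finset.sum_eq_single i] at h1
    · rw [map_mul] at h1
      have h2 : lineHom (P i) (Q i) (H i) ≠ 0 := by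
        rw [hH, map_prod, Finset.prod_ne_zero_iff]
        intro j hj
        rw [Finset.mem_erase] at hj
        exact hform1 i i.2 j hj.2 hj.1.symm
      have h3 := (mul_eq_zero.1 h1).resolve_right h2
      rw [← Polynomial.aeval_algHom_apply] at h3
      have h4 : lineHom (P i) (Q i) (X 0) =
          Polynomial.C (P i 0) + Polynomial.C (Q i 0) * Polynomial.X := by simp [lineHom]
      rw [h4] at h3
      have h5 : (Polynomial.C (P i 0) + Polynomial.C (Q i 0) * Polynomial.X).natDegree = 1 := by
        rw [add_comm]; exact Polynomial.natDegree_linear (hQ i i.2)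
      have h6 : (x.2.2 i : Polynomial k).comp
          (Polynomial.C (P i 0) + Polynomial.C (Q i 0) * Polynomial.X) = 0 := h3
      rcases Polynomial.comp_eq_zero_iff.1 h6 with h | h
      · exact Subtype.ext h
      · rw [h.2, Polynomial.natDegree_C] at h5
        omega
    · intro j _ hji
      have hji' : (j : ι) ≠ i := fun h => hji (Subtype.ext h)
      rw [map_mul, hH, map_prod, Finset.prod_eq_zero (i := (i : ι)), mul_zero]
      · exact Finset.mem_erase.2 ⟨hji'.symm, i.2⟩
      · exact hform0 j j.2 i i.2 hji'
    · intro h; exact absurd (Finset.mem_univ _) h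
  have hkereq : ∀ x ∈ LinearMap.ker Φ, f * (x.1 : MvPolynomial (Fin 3) k) =
      -(g * (x.2.1 : MvPolynomial (Fin 3) k)) := by
    intro x hx
    have h1 := hkerc x hx
    rw [LinearMap.mem_ker, hΦ, h1, map_zero, add_zero] at hx
    exact eq_neg_of_add_eq_zero_left hx
  let π : V →ₗ[k] MvPolynomial (Fin 3) k :=
    (boxPoly k N1).subtype ∘ₗ LinearMap.fst k _ _ ∘ₗ LinearMap.snd k _ _
  have hπinj : Function.Injective (π.domRestrict (LinearMap.ker Φ)) := by
    rw [injective_iff_map_eq_zero]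
    rintro ⟨x, hx⟩ h
    have h1 : (x.2.1 : MvPolynomial (Fin 3) k) = 0 := h
    have h2 := hkereq x hx
    rw [h1, mul_zero, neg_zero] at h2
    have h3 := (mul_eq_zero.1 h2).resolve_left hf0
    have h4 := hkerc x hx
    apply Subtype.ext
    exact Prod.ext (Subtype.ext h3) (Prod.ext (Subtype.ext h1) h4)
  have hπrange : LinearMap.range (π.domRestrict (LinearMap.ker Φ)) ≤
      (boxPoly k N2).map (LinearMap.mulLeft k f) := by
    rintro _ ⟨⟨x, hx⟩, rfl⟩
    have h2 := hkereq x hx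
    have h3 : f ∣ g * (x.2.1 : MvPolynomial (Fin 3) k) :=
      (dvd_neg.1 (h2 ▸ dvd_mul_right f _))
    obtain ⟨w, hw⟩ := (hf.dvd_or_dvd h3).resolve_left hfg
    refine ⟨w, ?_, hw.symm⟩
    by_cases hw0 : w = 0
    · rw [hw0]; exact Submodule.zero_mem _
    refine mem_boxPoly_of_degreeOf_lt fun i => ?_
    have h5 := degreeOf_lt_of_mem_boxPoly (hw ▸ mul_ne_zero hf0 hw0) x.2.1.2 i
    rw [hw, degreeOf_mul_eq hf0 hw0] at h5
    simp only [hN2, hD] at *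
    omega
  have : Module.Finite k V := by infer_instance
  have hker : Module.finrank k (LinearMap.ker Φ) ≤ ∏ i, N2 i := by
    rw [← LinearMap.finrank_range_of_inj hπinj, ← finrank_boxPoly (k := k)]
    exact (Submodule.finrank_mono hπrange).trans (Submodule.finrank_map_le _ _)
  have hran : Module.finrank k (LinearMap.range Φ) ≤ n ^ 3 := by
    refine (Submodule.finrank_mono hrange).trans ?_
    rw [finrank_boxPoly]; simp
  have hdim : Module.finrank k V = ∏ i, N1 i + (∏ i, N1 i + #L * M) := by
    simp only [V]
    rw [Module.finrank_prod, Module.finrank_prod, finrank_boxPoly, Module.finrank_pi_fintype]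
    simp [(Polynomial.degreeLTEquiv k M).finrank_eq]
  have hrn := LinearMap.finrank_range_add_finrank_ker Φ
  rw [hdim] at hrn
  have hfin : 2 * ∏ i, N1 i + #L * M ≤ n ^ 3 + ∏ i, N2 i := by omega
  simp only [Fin.prod_univ_three] at hfin
  have hD0 := hdf 0
  have hD1 := hdf 1
  have hD2 := hdf 2
  have e1 : ∀ i, D i ≤ d := hdf
  have eN1 : ∀ i, (N1 i : ℤ) = n - D i := fun i => by simp only [hN1]; have := e1 i; omega
  have eN2 : ∀ i, (N2 i : ℤ) = n - 2 * D i := fun i => by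
    simp only [hN2, hN1]; have := e1 i; omega
  have eM : (M : ℤ) = #L + 2 * d + 1 := by omega
  have hfinZ : 2 * ((N1 0 : ℤ) * N1 1 * N1 2) + #L * M ≤ n ^ 3 + N2 0 * N2 1 * N2 2 := by
    exact_mod_cast hfin
  rw [eN1, eN1, eN1, eN2, eN2, eN2, eM] at hfinZ
  zify
  exact lines_arith (by positivity) (by positivity) (by positivity) (by positivity)
    (by positivity) (by exact_mod_cast hD0) (by exact_mod_cast hD1) (by exact_mod_cast hD2)
    (by omega) hfinZ

end Lines

section Shifts
open MvPolynomial
variable {k : Type*} [Field k]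

theorem degreeOf_aeval_le (g : Fin 3 → MvPolynomial (Fin 3) k) (v : Fin 3)
    (hg : ∀ i, degreeOf v (g i) ≤ if i = v then 1 else 0) (f : MvPolynomial (Fin 3) k) :
    degreeOf v (aeval g f) ≤ degreeOf v f := by
  rw [aeval_def, eval₂_eq]
  refine (degreeOf_sum_le _ _ _).trans (Finset.sup_le fun m hm => ?_)
  rw [algebraMap_eq]
  refine (degreeOf_C_mul_le _ _ _).trans ((degreeOf_prod_le _ _ _).trans ?_)
  refine le_trans ?_ (monomial_le_degreeOf v hm)
  calc ∑ i ∈ m.support, degreeOf v (g i ^ m i)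
      ≤ ∑ i ∈ m.support, if i = v then m v else 0 := by
        refine Finset.sum_le_sum fun i _ => (degreeOf_pow_le _ _ _).trans ?_
        refine (Nat.mul_le_mul_left _ (hg i)).trans ?_
        split_ifs with h <;> simp [h]
    _ ≤ m v := by
        rw [Finset.sum_ite_eq']
        split_ifs <;> simp

theorem totalDegree_aeval_le (g : Fin 3 → MvPolynomial (Fin 3) k)
    (hg : ∀ i, totalDegree (g i) ≤ 1) (f : MvPolynomial (Fin 3) k) :
    totalDegree (aeval g f) ≤ totalDegree f := by
  rw [aeval_def, eval₂_eq]
  refine (totalDegree_finsetSum_le fun m hm => ?_)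
  rw [algebraMap_eq]
  refine (totalDegree_mul _ _).trans ?_
  rw [totalDegree_C, zero_add]
  refine (totalDegree_finsetProd _ _).trans ?_
  refine le_trans ?_ (le_totalDegree hm)
  refine Finset.sum_le_sum fun i _ => (totalDegree_pow _ _).trans ?_
  simpa using Nat.mul_le_mul_left (m i) (hg i)

/-- Translation of a polynomial by a vector. -/
noncomputable def shiftHom (v : Fin 3 → k) : MvPolynomial (Fin 3) k →ₐ[k] MvPolynomial (Fin 3) k :=
  aeval fun i => X i - C (v i)

theorem shiftHom_shiftHom_neg (v : Fin 3 → k) (f : MvPolynomial (Fin 3) k) :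
    shiftHom v (shiftHom (-v) f) = f := by
  have : (shiftHom v).comp (shiftHom (-v)) = AlgHom.id k (MvPolynomial (Fin 3) k) := by
    ext i
    simp [shiftHom]
  exact DFunLike.congr_fun this f

theorem degreeOf_shiftHom_le (u : Fin 3) (v : Fin 3 → k) (f : MvPolynomial (Fin 3) k) :
    degreeOf u (shiftHom v f) ≤ degreeOf u f := by
  refine degreeOf_aeval_le _ _ (fun i => ?_) f
  rw [sub_eq_add_neg, ← C_neg]
  refine (degreeOf_add_le _ _ _).trans ?_
  rw [degreeOf_C, degreeOf_X]
  split_ifs with h1 h2 h2 <;> simp_all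

theorem degreeOf_shiftHom (u : Fin 3) (v : Fin 3 → k) (f : MvPolynomial (Fin 3) k) :
    degreeOf u (shiftHom v f) = degreeOf u f := by
  refine le_antisymm (degreeOf_shiftHom_le u v f) ?_
  conv_lhs => rw [← shiftHom_shiftHom_neg (-v) f, neg_neg]
  exact degreeOf_shiftHom_le _ _ _

theorem eval_shiftHom (x v : Fin 3 → k) (f : MvPolynomial (Fin 3) k) :
    eval x (shiftHom v f) = eval (x - v) f := by
  have : (aeval x : MvPolynomial (Fin 3) k →ₐ[k] k).comp (shiftHom v) = aeval (x - v) := by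
    ext i
    simp [shiftHom]
  simpa [coe_aeval_eq_eval] using DFunLike.congr_fun this f

theorem lineHom_shiftHom (P Q v : Fin 3 → k) (f : MvPolynomial (Fin 3) k) :
    lineHom P Q (shiftHom v f) = lineHom (P - v) Q f := by
  have : (lineHom P Q).comp (shiftHom v) = lineHom (P - v) Q := by
    ext i : 1
    simp [shiftHom, lineHom]
    ring
  exact DFunLike.congr_fun this f

theorem eval_lineHom (P Q : Fin 3 → k) (t : k) (f : MvPolynomial (Fin 3) k) :
    (lineHom P Q f).eval t = eval (P + t • Q) f := by
  have : (Polynomial.aeval t).comp (lineHom P Q) = (aeval (P + t • Q) :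
      MvPolynomial (Fin 3) k →ₐ[k] k) := by
    ext i
    simp [lineHom]
    ring
  simpa [coe_aeval_eq_eval, Polynomial.coe_aeval_eq_eval] using DFunLike.congr_fun this f

theorem prime_shiftHom (v : Fin 3 → k) {f : MvPolynomial (Fin 3) k} (hf : Prime f) :
    Prime (shiftHom v f) := by
  let e : MvPolynomial (Fin 3) k ≃ₐ[k] MvPolynomial (Fin 3) k :=
    AlgEquiv.ofAlgHom (shiftHom v) (shiftHom (-v))
      (AlgHom.ext fun f => shiftHom_shiftHom_neg v f)
      (AlgHom.ext fun f => by simpa using shiftHom_shiftHom_neg (-v) f)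
  exact (MulEquiv.prime_iff e.toMulEquiv).2 hf

/-- If one translate of a polynomial divides another, the zero set is periodic. -/
theorem eval_sub_eq_zero_of_dvd {v v' : Fin 3 → k} {f : MvPolynomial (Fin 3) k}
    (h : shiftHom v f ∣ shiftHom v' f) {x : Fin 3 → k} (hx : eval x f = 0) :
    eval (x - (v' - v)) f = 0 := by
  obtain ⟨g, hg⟩ := h
  have := congrArg (eval (x + v)) hg
  rw [map_mul, eval_shiftHom, eval_shiftHom, add_sub_cancel_right, hx, zero_mul] at this
  rw [← this]
  congr 2
  abel

theorem sub_dvd_sub_aeval_update (i : Fin 3) (ρ f : MvPolynomial (Fin 3) k) :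
    X i - ρ ∣ f - aeval (Function.update X i ρ) f := by
  rw [← Ideal.mem_span_singleton, ← Ideal.Quotient.eq]
  have : (Ideal.Quotient.mkₐ k (Ideal.span {X i - ρ})) =
      (Ideal.Quotient.mkₐ k (Ideal.span {X i - ρ})).comp (aeval (Function.update X i ρ)) := by
    ext j
    rcases eq_or_ne j i with rfl | hj
    · simp only [AlgHom.comp_apply, aeval_X, Function.update_self, Ideal.Quotient.mkₐ_eq_mk]
      rw [Ideal.Quotient.eq]
      exact Ideal.mem_span_singleton_self _
    · simp [hj]
  simpa using DFunLike.congr_fun this f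

theorem irreducible_factor_of_many_lines [DecidableEq (Polynomial k)] {ι : Type*} [DecidableEq ι] (L : Finset ι)
    (P Q : ι → Fin 3 → k) (R : ℝ) :
    ∀ (D : ℕ) (F : MvPolynomial (Fin 3) k), totalDegree F ≤ D → F ≠ 0 → 0 < totalDegree F →
      R * totalDegree F ≤ #{i ∈ L | lineHom (P i) (Q i) F = 0} →
      ∃ f : MvPolynomial (Fin 3) k, Irreducible f ∧ 0 < totalDegree f ∧ totalDegree f ≤ D ∧
        R * totalDegree f ≤ #{i ∈ L | lineHom (P i) (Q i) f = 0} := by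
  intro D
  induction D using Nat.strong_induction_on with
  | _ D ih =>
  intro F hFD hF0 hF1 hF
  have hunit : ∀ g : MvPolynomial (Fin 3) k, g ≠ 0 → ¬ IsUnit g → 0 < totalDegree g := by
    intro g hg hgu
    by_contra! h
    obtain h := Nat.le_zero.1 h
    rw [totalDegree_eq_zero_iff_eq_C] at h
    apply hgu
    rw [h]
    refine IsUnit.map C (isUnit_iff_ne_zero.2 fun h0 => hg ?_)
    rw [h, h0, C_0]
  by_cases hirr : Irreducible F
  · exact ⟨F, hirr, hF1, hFD, hF⟩
  have hFu : ¬ IsUnit F := fun h => by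
    have := (isUnit_iff_totalDegree_of_isReduced.1 h).2
    omega
  rw [irreducible_iff] at hirr
  push Not at hirr
  obtain ⟨g, h, rfl, hg, hh⟩ := hirr hFu
  have hg0 : g ≠ 0 := left_ne_zero_of_mul hF0
  have hh0 : h ≠ 0 := right_ne_zero_of_mul hF0
  have hdeg := totalDegree_mul_of_isDomain hg0 hh0
  have hg1 := hunit g hg0 hg
  have hh1 := hunit h hh0 hh
  have hcard : #{i ∈ L | lineHom (P i) (Q i) (g * h) = 0} ≤
      #{i ∈ L | lineHom (P i) (Q i) g = 0} +
      #{i ∈ L | lineHom (P i) (Q i) h = 0} := by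
    simp only [map_mul, mul_eq_zero]
    rw [Finset.filter_or]
    exact Finset.card_union_le _ _
  have hcard' : (#{i ∈ L | lineHom (P i) (Q i) (g * h) = 0} : ℝ) ≤
      #{i ∈ L | lineHom (P i) (Q i) g = 0} +
      #{i ∈ L | lineHom (P i) (Q i) h = 0} := by exact_mod_cast hcard
  rw [hdeg] at hF
  push_cast at hF
  rcases le_or_gt (R * totalDegree g) (#{i ∈ L | lineHom (P i) (Q i) g = 0}) with h1 | h1
  · obtain ⟨f, a, b, c, d⟩ := ih (totalDegree g) (by omega) g le_rfl hg0 hg1 h1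
    exact ⟨f, a, b, by omega, d⟩
  · obtain ⟨f, a, b, c, d⟩ := ih (totalDegree h) (by omega) h le_rfl hh0 hh1 (by linarith)
    exact ⟨f, a, b, by omega, d⟩

end Shifts

section Planes
open MvPolynomial
variable {p : ℕ} [Fact p.Prime]

/-- If an irreducible polynomial of degree less than `p` vanishes at every point of the plane
`X i = ρ`, then every line on which it vanishes lies in that plane. -/
theorem lineHom_graph_eq_zero {f : MvPolynomial (Fin 3) (ZMod p)} (hf : Irreducible f)
    (hdeg : totalDegree f < p) (i : Fin 3) (ρ : MvPolynomial (Fin 3) (ZMod p))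
    (hρ : totalDegree ρ ≤ 1) (hne : ∃ q, eval q ρ = q i)
    (hvan : ∀ q, eval (Function.update q i (eval q ρ)) f = 0) (P Q : Fin 3 → ZMod p)
    (hline : lineHom P Q f = 0) : lineHom P Q (X i - ρ) = 0 := by
  have h0 : aeval (Function.update X i ρ) f = 0 := by
    refine eq_zero_of_eval_zero_at_prod_finset _ (fun _ => Finset.univ) (fun j => ?_) fun q _ => ?_
    · rw [Finset.card_univ, ZMod.card]
      refine lt_of_le_of_lt ((degreeOf_le_totalDegree _ _).trans (totalDegree_aeval_le _ ?_ f)) hdeg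
      intro j
      rcases eq_or_ne j i with rfl | hj
      · simpa using hρ
      · simp [hj]
    · rw [← hvan q]
      have : (aeval q : MvPolynomial (Fin 3) (ZMod p) →ₐ[ZMod p] ZMod p).comp
          (aeval (Function.update X i ρ)) = aeval (Function.update q i (eval q ρ)) := by
        ext j
        rcases eq_or_ne j i with rfl | hj
        · simp
        · simp [hj]
      simpa [coe_aeval_eq_eval] using DFunLike.congr_fun this f
  have h1 := sub_dvd_sub_aeval_update i ρ f
  rw [h0, sub_zero] at h1
  obtain ⟨g, hg⟩ := h1
  have hu : ¬ IsUnit (X i - ρ) := by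
    obtain ⟨q, hq⟩ := hne
    intro h
    have := h.map (eval q)
    rw [map_sub, eval_X, hq, sub_self] at this
    exact not_isUnit_zero this
  have hgu := (hf.isUnit_or_isUnit hg).resolve_left hu
  rw [hg, map_mul] at hline
  exact (mul_eq_zero.1 hline).resolve_right (hgu.map (lineHom P Q)).ne_zero

/-- Base point of the line attached to `(y, w, a)`. -/
def lineBase (κ : ZMod p) (i : ZMod p × ZMod p × ZMod p) : Fin 3 → ZMod p :=
  ![i.2.2, 0, i.2.1 + κ * i.1]

/-- Direction of the line attached to `(y, w, a)`. -/
def lineDir (i : ZMod p × ZMod p × ZMod p) : Fin 3 → ZMod p := ![1, -i.1, i.1 ^ 2]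

open scoped Classical in
theorem card_lines_le_of_periodic {Y W A : Finset (ZMod p)} (hY : 0 ∉ Y) (κ : ZMod p)
    {f : MvPolynomial (Fin 3) (ZMod p)} (hf : Irreducible f) (hdeg : totalDegree f < p)
    {x z : ZMod p} (hxz : x ≠ 0 ∨ z ≠ 0)
    (hper : ∀ q, eval q f = 0 → eval (q - ![x, 0, z]) f = 0) :
    #{i ∈ Y ×ˢ W ×ˢ A | lineHom (lineBase κ i) (lineDir i) f = 0} ≤ 2 * #A + #W := by
  rcases Finset.eq_empty_or_nonempty
    {i ∈ Y ×ˢ W ×ˢ A | lineHom (lineBase κ i) (lineDir i) f = 0} with h | ⟨⟨y, w, a⟩, hi⟩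
  · rw [h]; simp
  rw [Finset.mem_filter, Finset.mem_product] at hi
  obtain ⟨⟨hyY, -⟩, hl⟩ := hi
  have hy : y ≠ 0 := fun h => hY (h ▸ hyY)
  set e := w + κ * y with he
  have hv : ∀ t c : ZMod p, eval ![a + t + c * x, -(y * t), e + y ^ 2 * t + c * z] f = 0 := by
    intro t c
    have key : ∀ n : ℕ, eval ![a + t - n * x, -(y * t), e + y ^ 2 * t - n * z] f = 0 := by
      intro n
      induction n with
      | zero =>
        have := congrArg (Polynomial.eval t) hl
        rw [eval_lineHom, Polynomial.eval_zero] at this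
        rw [← this]
        congr 2
        funext j
        fin_cases j <;> simp [lineBase, lineDir, he] <;> ring
      | succ n ih =>
        rw [← hper _ ih]
        congr 2
        funext j
        fin_cases j <;> simp <;> ring
    have := key (-c).val
    rw [ZMod.natCast_zmod_val] at this
    rw [← this]
    congr 2
    funext j
    fin_cases j <;> simp
  have ht : ∀ (r : ZMod p) (j : Fin 3), totalDegree (C r * X j : MvPolynomial (Fin 3) (ZMod p)) ≤ 1 :=
    fun r j => (totalDegree_mul _ _).trans (by simp)
  have hC : ∀ r : ZMod p, totalDegree (C r : MvPolynomial (Fin 3) (ZMod p)) ≤ 1 := fun r => by simp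
  by_cases hx : x = 0
  · have hz : z ≠ 0 := hxz.resolve_left (not_not.2 hx)
    set ρ : MvPolynomial (Fin 3) (ZMod p) := C a + C (-y⁻¹) * X 1 with hρ
    have hρe : ∀ q : Fin 3 → ZMod p, eval q ρ = a - y⁻¹ * q 1 := fun q => by simp [hρ]; ring
    have hpl := lineHom_graph_eq_zero hf hdeg 0 ρ
      ((totalDegree_add _ _).trans (max_le (hC _) (ht _ _)))
      ⟨![a, 0, 0], by simp [hρe]⟩ (fun q => by
        rw [← hv (-(y⁻¹ * q 1)) ((q 2 - e - y ^ 2 * (-(y⁻¹ * q 1))) / z), hρe, hx]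
        congr 2
        funext j
        fin_cases j <;> simp <;> field_simp <;> ring)
    refine le_trans (Finset.card_le_card (t := W.image fun w => (y, w, a)) ?_)
      (Finset.card_image_le.trans (by omega))
    rintro ⟨y1, w1, a1⟩ h1
    rw [Finset.mem_filter, Finset.mem_product, Finset.mem_product] at h1
    obtain ⟨⟨hy1, hw1, ha1⟩, hl1⟩ := h1
    have h2 := hpl _ _ hl1
    have h3 := congrArg (Polynomial.eval 0) h2
    have h4 := congrArg (Polynomial.eval 1) h2
    rw [eval_lineHom, map_sub, hρe] at h3 h4
    simp [lineBase, lineDir] at h3 h4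
    have h5 : a1 = a := by linear_combination h3
    have h6 : y1 = y := by
      field_simp at h4
      linear_combination (-1) * h4 + y * h3
    rw [Finset.mem_image]
    exact ⟨w1, hw1, by rw [h5, h6]⟩
  · set ρ : MvPolynomial (Fin 3) (ZMod p) := C (e - z / x * a) + C (z / x) * X 0 +
      C (-y + z / x * y⁻¹) * X 1 with hρ
    have hρe : ∀ q : Fin 3 → ZMod p, eval q ρ = e - z / x * a + z / x * q 0 +
      (-y + z / x * y⁻¹) * q 1 := fun q => by simp [hρ]
    have hpl := lineHom_graph_eq_zero hf hdeg 2 ρ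
      ((totalDegree_add _ _).trans (max_le ((totalDegree_add _ _).trans
        (max_le (hC _) (ht _ _))) (ht _ _)))
      ⟨![a, 0, e], by simp [hρe]⟩ (fun q => by
        rw [← hv (-(y⁻¹ * q 1)) ((q 0 - a + (y⁻¹ * q 1)) / x), hρe]
        congr 2
        funext j
        fin_cases j <;> simp <;> field_simp <;> ring)
    refine le_trans (Finset.card_le_card (t := (({y, -(z / x * y⁻¹)} : Finset (ZMod p)) ×ˢ A).image
      fun r => (r.1, e + z / x * (r.2 - a) - κ * r.1, r.2)) ?_) (Finset.card_image_le.trans ?_)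
    · rintro ⟨y1, w1, a1⟩ h1
      rw [Finset.mem_filter, Finset.mem_product, Finset.mem_product] at h1
      obtain ⟨⟨hy1, hw1, ha1⟩, hl1⟩ := h1
      have h2 := hpl _ _ hl1
      have h3 := congrArg (Polynomial.eval 0) h2
      have h4 := congrArg (Polynomial.eval 1) h2
      rw [eval_lineHom, map_sub, hρe] at h3 h4
      simp [lineBase, lineDir] at h3 h4
      have h5 : (y1 - y) * (y1 + z / x * y⁻¹) = 0 := by
        field_simp at h3 h4 ⊢
        linear_combination h4 - y * h3
      rw [Finset.mem_image]
      refine ⟨(y1, a1), Finset.mem_product.2 ⟨?_, ha1⟩, ?_⟩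
      · rcases mul_eq_zero.1 h5 with h | h
        · simp [sub_eq_zero.1 h]
        · simp [eq_neg_of_add_eq_zero_left h]
      · refine Prod.ext rfl (Prod.ext ?_ rfl)
        simp only
        linear_combination (-1) * h3
    · rw [Finset.card_product]
      have := Finset.card_le_two (a := y) (b := -(z / x * y⁻¹))
      nlinarith [Nat.zero_le #W]

end Planes

theorem sq_sum_card_le {α β : Type*} [DecidableEq α] [DecidableEq β] (V : Finset α) (E : Finset β)
    (Z : α → Finset β) (hZ : ∀ v ∈ V, Z v ⊆ E) (B : ℕ)
    (hB : ∀ v ∈ V, ∀ v' ∈ V, v ≠ v' → #(Z v ∩ Z v') ≤ B) :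
    (∑ v ∈ V, #(Z v)) ^ 2 ≤ #E * (∑ v ∈ V, #(Z v) + #V ^ 2 * B) := by
  have h1 : ∑ v ∈ V, #(Z v) = ∑ e ∈ E, #{v ∈ V | e ∈ Z v} := by
    refine Eq.trans ?_
      (Finset.sum_card_bipartiteAbove_eq_sum_card_bipartiteBelow (fun v e => e ∈ Z v))
    refine Finset.sum_congr rfl fun v hv => ?_
    rw [Finset.bipartiteAbove, Finset.filter_mem_eq_inter, Finset.inter_eq_right.2 (hZ v hv)]
  have h2 : ∑ e ∈ E, #{v ∈ V | e ∈ Z v} ^ 2 = ∑ v ∈ V, ∑ v' ∈ V, #(Z v ∩ Z v') := by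
    have h3 : ∀ e, #{v ∈ V | e ∈ Z v} ^ 2 =
        ∑ v ∈ V, ∑ v' ∈ V, if e ∈ Z v ∩ Z v' then 1 else 0 := by
      intro e
      rw [sq, Finset.card_filter, Finset.sum_mul_sum]
      refine Finset.sum_congr rfl fun v _ => Finset.sum_congr rfl fun v' _ => ?_
      by_cases h : e ∈ Z v <;> by_cases h' : e ∈ Z v' <;> simp [h, h']
    simp_rw [h3]
    rw [Finset.sum_comm]
    refine Finset.sum_congr rfl fun v hv => ?_
    rw [Finset.sum_comm]
    refine Finset.sum_congr rfl fun v' _ => ?_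
    rw [← Finset.card_filter, Finset.filter_mem_eq_inter,
      Finset.inter_eq_right.2 (Finset.inter_subset_left.trans (hZ v hv))]
  calc (∑ v ∈ V, #(Z v)) ^ 2 ≤ #E * ∑ e ∈ E, #{v ∈ V | e ∈ Z v} ^ 2 := by
        rw [h1]; exact sq_sum_le_card_mul_sum_sq
    _ ≤ _ := by
        rw [h2]
        refine Nat.mul_le_mul_left _ ?_
        have h4 : ∀ v ∈ V, ∑ v' ∈ V, #(Z v ∩ Z v') ≤ #(Z v) + #V * B := by
          intro v hv
          rw [← Finset.add_sum_erase _ _ hv, Finset.inter_self]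
          refine Nat.add_le_add_left ?_ _
          refine (Finset.sum_le_card_nsmul _ _ B fun v' hv' => ?_).trans ?_
          · rw [Finset.mem_erase] at hv'
            exact hB v hv v' hv'.2 hv'.1.symm
          · rw [smul_eq_mul]
            exact Nat.mul_le_mul_right _ (Finset.card_le_card (Finset.erase_subset _ _))
        refine (Finset.sum_le_sum h4).trans ?_
        rw [Finset.sum_add_distrib, Finset.sum_const, smul_eq_mul, sq, mul_assoc]

section Degree
open MvPolynomial
variable {p : ℕ} [Fact p.Prime]

set_option maxHeartbeats 1000000 in
open scoped Classical in
theorem degree_alternatives {Y W A : Finset (ZMod p)} (hY : 0 ∉ Y) (hA : A.Nonempty) (κ : ZMod p)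
    {F : MvPolynomial (Fin 3) (ZMod p)} (hF0 : F ≠ 0) (hF1 : 0 < totalDegree F)
    (hFp : totalDegree F < p) {R : ℝ} (hR0 : 0 < R)
    (hR : R * totalDegree F ≤
      #{i ∈ Y ×ˢ W ×ˢ A | lineHom (lineBase κ i) (lineDir i) F = 0}) :
    R ≤ 2 * #A + #W ∨ R * (#A : ℝ) ^ 2 ≤ 2 * (#Y * #(W + A) * #(A + A)) ∨
      R ^ 2 ≤ 24 * (#Y * #(W + A) * #(A + A)) := by
  obtain ⟨f, hirr, hf1, hfD, hfR⟩ := irreducible_factor_of_many_lines (Y ×ˢ W ×ˢ A)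
    (lineBase κ) lineDir R (totalDegree F) F le_rfl hF0 hF1 hR
  set d := totalDegree f with hd
  set E := Y ×ˢ (W + A) ×ˢ (A + A) with hE
  let vec : ZMod p × ZMod p → Fin 3 → ZMod p := fun v => ![v.1, 0, v.2]
  have hfp : Prime f := hirr.prime
  by_cases hdiv : ∃ v v', v ≠ v' ∧ shiftHom (vec v) f ∣ shiftHom (vec v') f
  · left
    obtain ⟨v, v', hne, hdvd⟩ := hdiv
    have hxz : v'.1 - v.1 ≠ 0 ∨ v'.2 - v.2 ≠ 0 := by
      by_contra! h
      exact hne (Prod.ext (sub_eq_zero.1 h.1).symm (sub_eq_zero.1 h.2).symm)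
    have h := card_lines_le_of_periodic (W := W) (A := A) hY κ hirr (lt_of_le_of_lt hfD hFp) hxz
      (fun q hq => by
        have := eval_sub_eq_zero_of_dvd hdvd hq
        have hvec : (![v'.1 - v.1, 0, v'.2 - v.2] : Fin 3 → ZMod p) = vec v' - vec v := by
          funext j
          fin_cases j <;> simp [vec]
        rw [hvec, this])
    have h' : ((#{i ∈ Y ×ˢ W ×ˢ A | lineHom (lineBase κ i) (lineDir i) f = 0} : ℕ) : ℝ) ≤
        2 * #A + #W := by exact_mod_cast h
    have hd1 : (1 : ℝ) ≤ d := by exact_mod_cast hf1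
    nlinarith
  right
  push Not at hdiv
  let Z : ZMod p × ZMod p → Finset (ZMod p × ZMod p × ZMod p) := fun v =>
    {i ∈ E | lineHom (lineBase κ i) (lineDir i) (shiftHom (vec v) f) = 0}
  have hZ : ∀ v ∈ A ×ˢ A, R * d ≤ #(Z v) := by
    intro v hv
    rw [Finset.mem_product] at hv
    refine hfR.trans (Nat.cast_le.2 ?_)
    refine Finset.card_le_card_of_injOn (fun i => (i.1, i.2.1 + v.2, i.2.2 + v.1)) ?_ ?_
    · intro i hi
      simp only [Finset.coe_filter, Set.mem_ofPred_eq, Finset.mem_product] at hi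
      simp only [Z, hE, Finset.coe_filter, Set.mem_ofPred_eq, Finset.mem_product]
      refine ⟨⟨hi.1.1, Finset.add_mem_add hi.1.2.1 hv.2, Finset.add_mem_add hi.1.2.2 hv.1⟩, ?_⟩
      rw [lineHom_shiftHom, ← hi.2]
      congr 2
      funext j
      fin_cases j
      · simp [lineBase, vec]
      · simp [lineBase, vec]
      · simp [lineBase, vec]
        ring
    · rintro ⟨a, b, c⟩ - ⟨a', b', c'⟩ - h
      simpa using h
  let form1 : ZMod p × ZMod p × ZMod p → MvPolynomial (Fin 3) (ZMod p) := fun j =>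
    X 1 + C j.1 * X 0 + C (-(j.1 * j.2.2))
  let form2 : ZMod p × ZMod p × ZMod p → MvPolynomial (Fin 3) (ZMod p) := fun j =>
    X 2 + C (-(j.1 ^ 2)) * X 0 + C (j.1 ^ 2 * j.2.2 - (j.2.1 + κ * j.1))
  have hlin : ∀ (m : Fin 3) (r s : ZMod p) (v : Fin 3), m ≠ 0 →
      degreeOf v (X m + C r * X 0 + C s : MvPolynomial (Fin 3) (ZMod p)) ≤ 1 := by
    intro m r s v hm
    have hX : ∀ j : Fin 3, degreeOf v (X j : MvPolynomial (Fin 3) (ZMod p)) ≤ 1 := fun j => by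
      rw [degreeOf_X]; split_ifs <;> simp
    refine (degreeOf_add_le _ _ _).trans (max_le ((degreeOf_add_le _ _ _).trans
      (max_le (hX m) ((degreeOf_C_mul_le _ _ _).trans (hX 0)))) ?_)
    rw [degreeOf_C]; simp
  have hform1 : ∀ i j : ZMod p × ZMod p × ZMod p, lineHom (lineBase κ i) (lineDir i) (form1 j) =
      Polynomial.C (j.1 * (i.2.2 - j.2.2)) + Polynomial.C (j.1 - i.1) * Polynomial.X := by
    intro i j
    simp only [form1, lineHom, lineBase, lineDir, map_add, map_mul, aeval_X, algHom_C]
    simp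
    ring
  have hform2 : ∀ i j : ZMod p × ZMod p × ZMod p, lineHom (lineBase κ i) (lineDir i) (form2 j) =
      Polynomial.C (i.2.1 + κ * i.1 - (j.2.1 + κ * j.1) - j.1 ^ 2 * (i.2.2 - j.2.2)) +
        Polynomial.C (i.1 ^ 2 - j.1 ^ 2) * Polynomial.X := by
    intro i j
    simp only [form2, lineHom, lineBase, lineDir, map_add, map_mul, aeval_X, algHom_C]
    simp
    ring
  have hinter : ∀ v ∈ A ×ˢ A, ∀ v' ∈ A ×ˢ A, v ≠ v' → #(Z v ∩ Z v') ≤ 12 * d ^ 2 := by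
    intro v _ v' _ hne
    refine card_common_lines_le (Z v ∩ Z v') (lineBase κ) lineDir (fun i _ => by simp [lineDir])
      (fun i j => if lineHom (lineBase κ i) (lineDir i) (form1 j) ≠ 0 then form1 j else form2 j)
      (fun i j v => ?_) (fun i _ j _ _ => ?_) (fun i hi j hj hij => ?_)
      (shiftHom (vec v) f) (shiftHom (vec v') f) (prime_shiftHom _ hfp) (hdiv v v' hne) d
      (fun u => ?_) (fun u => ?_) (fun i hi => ?_) (fun i hi => ?_)
    · split_ifs
      · exact hlin _ _ _ _ (by decide)
      · exact hlin _ _ _ _ (by decide)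
    · split_ifs
      · rw [hform1]; simp
      · rw [hform2]; simp
    · split_ifs with h
      · exact h
      · rw [not_not, hform1] at h
        have hc0 := congrArg (fun g => Polynomial.coeff g 0) h
        have hc1 := congrArg (fun g => Polynomial.coeff g 1) h
        simp at hc0 hc1
        have e1 : j.1 = i.1 := sub_eq_zero.1 hc1
        have hj0 : j.1 ≠ 0 := by
          intro h0
          simp only [Z, hE, Finset.mem_inter, Finset.mem_filter, Finset.mem_product] at hj
          exact hY (h0 ▸ hj.1.1.1)
        have e2 : i.2.2 = j.2.2 := sub_eq_zero.1 (hc0.resolve_left hj0)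
        intro h2
        rw [hform2] at h2
        have hd0 := congrArg (fun g => Polynomial.coeff g 0) h2
        simp [e1, e2, sub_eq_zero] at hd0
        exact hij (Prod.ext e1.symm (Prod.ext hd0 e2))
    · rw [degreeOf_shiftHom]; exact degreeOf_le_totalDegree _ _
    · rw [degreeOf_shiftHom, degreeOf_shiftHom]
    · exact (Finset.mem_filter.1 (Finset.mem_inter.1 hi).1).2
    · exact (Finset.mem_filter.1 (Finset.mem_inter.1 hi).2).2
  have hcs := sq_sum_card_le (A ×ˢ A) E Z (fun v _ => Finset.filter_subset _ _) _ hinter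
  have hEc : (#E : ℝ) = #Y * #(W + A) * #(A + A) := by
    rw [hE, Finset.card_product, Finset.card_product]; push_cast; ring
  rw [← hEc]
  have hs : (#A : ℝ) ^ 2 * (R * d) ≤ ((∑ v ∈ A ×ˢ A, #(Z v) : ℕ) : ℝ) := by
    push_cast
    have := Finset.card_nsmul_le_sum (A ×ˢ A) (fun v => (#(Z v) : ℝ)) (R * d) hZ
    rw [Finset.card_product, nsmul_eq_mul] at this
    push_cast at this
    rw [sq]; exact this
  set s := ∑ v ∈ A ×ˢ A, #(Z v) with hsdef
  have hcs' : (s : ℝ) ^ 2 ≤ #E * (s + ((#A : ℝ) * #A) ^ 2 * (12 * d ^ 2)) := by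
    rw [Finset.card_product A A] at hcs
    exact_mod_cast hcs
  have hd1 : (1 : ℝ) ≤ d := by exact_mod_cast hf1
  have hA0 : (0 : ℝ) < #A := by exact_mod_cast hA.card_pos
  have hs0 : (0 : ℝ) < s := lt_of_lt_of_le (by positivity) hs
  have hE0 : (0 : ℝ) ≤ #E := by positivity
  rcases le_or_gt (s : ℝ) (2 * #E) with h | h
  · left
    refine le_trans ?_ (hs.trans h)
    have : (0 : ℝ) ≤ (#A : ℝ) ^ 2 * R := by positivity
    nlinarith
  · right
    have h1 : (s : ℝ) ^ 2 ≤ 24 * #E * ((#A : ℝ) ^ 4 * d ^ 2) := by nlinarith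
    have h2 : ((#A : ℝ) ^ 2 * (R * d)) ^ 2 ≤ (s : ℝ) ^ 2 := by gcongr
    have h3 : R ^ 2 * ((#A : ℝ) ^ 4 * d ^ 2) ≤ 24 * #E * ((#A : ℝ) ^ 4 * d ^ 2) := by
      refine le_trans (le_of_eq ?_) (h2.trans h1)
      ring
    exact le_of_mul_le_mul_right h3 (by positivity)

end Degree

section Vanishing
open MvPolynomial
variable {k : Type*} [Field k]

theorem natDegree_lineHom_le (P Q : Fin 3 → k) (f : MvPolynomial (Fin 3) k) :
    (lineHom P Q f).natDegree ≤ totalDegree f := by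
  rw [lineHom, aeval_def, eval₂_eq]
  refine Polynomial.natDegree_sum_le_of_forall_le _ _ fun m hm => ?_
  refine (Polynomial.natDegree_C_mul_le _ _).trans ((Polynomial.natDegree_prod_le _ _).trans ?_)
  refine le_trans ?_ (le_totalDegree hm)
  refine Finset.sum_le_sum fun i _ => Polynomial.natDegree_pow_le.trans ?_
  have : (Polynomial.C (P i) + Polynomial.C (Q i) * Polynomial.X).natDegree ≤ 1 := by
    rw [add_comm]; exact Polynomial.natDegree_linear_le
  simpa using Nat.mul_le_mul_left (m i) this

theorem totalDegree_le_of_mem_boxPoly {n : ℕ} {f : MvPolynomial (Fin 3) k}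
    (hf : f ∈ boxPoly k fun _ => n) : totalDegree f ≤ 3 * (n - 1) := by
  rw [mem_boxPoly_iff] at hf
  refine Finset.sup_le fun m hm => ?_
  rw [Finsupp.sum_fintype _ _ (fun _ => rfl), Fin.sum_univ_three]
  have h0 := hf m hm 0
  have h1 := hf m hm 1
  have h2 := hf m hm 2
  omega

/-- A nonzero polynomial of small degree vanishing on given lines. -/
theorem exists_polynomial_vanishing_on_lines {ι : Type*} (M : Finset ι) (P Q : ι → Fin 3 → k)
    (n : ℕ) (hn : #M * (3 * n) < n ^ 3) :
    ∃ F : MvPolynomial (Fin 3) k, F ≠ 0 ∧ totalDegree F < 3 * n ∧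
      ∀ i ∈ M, lineHom (P i) (Q i) F = 0 := by
  have hn0 : 0 < n := by
    rcases Nat.eq_zero_or_pos n with rfl | h
    · simp at hn
    · exact h
  have htd : ∀ f ∈ boxPoly k fun _ => n, totalDegree f < 3 * n := fun f hf => by
    have := totalDegree_le_of_mem_boxPoly hf
    omega
  let Φ : (boxPoly k fun _ => n) →ₗ[k] (M → Polynomial.degreeLT k (3 * n)) :=
    LinearMap.pi fun i => LinearMap.codRestrict _
      ((lineHom (P i) (Q i)).toLinearMap ∘ₗ (boxPoly k fun _ => n).subtype) fun f => by
        rw [Polynomial.mem_degreeLT]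
        refine lt_of_le_of_lt Polynomial.degree_le_natDegree ?_
        have h1 := natDegree_lineHom_le (P i) (Q i) (f : MvPolynomial (Fin 3) k)
        have h2 := htd f f.2
        exact_mod_cast lt_of_le_of_lt h1 h2
  have hrank : Module.finrank k (M → Polynomial.degreeLT k (3 * n)) <
      Module.finrank k (boxPoly k fun _ => n) := by
    rw [finrank_boxPoly, Module.finrank_pi_fintype]
    simpa [(Polynomial.degreeLTEquiv k (3 * n)).finrank_eq] using hn
  obtain ⟨f, hf, hf0⟩ := Submodule.exists_mem_ne_zero_of_ne_bot
    (LinearMap.ker_ne_bot_of_finrank_lt (f := Φ) hrank)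
  refine ⟨f, fun h => hf0 (Subtype.ext h), htd f f.2, fun i hi => ?_⟩
  have h1 := congrFun (LinearMap.mem_ker.1 hf) ⟨i, hi⟩
  exact congrArg Subtype.val h1

end Vanishing

theorem card_le_card_image_add_collisions {α γ : Type*} [DecidableEq α] [DecidableEq γ]
    (T : Finset α) (t : α → γ) :
    #T ≤ #(T.image t) + #{x ∈ T.offDiag | t x.1 = t x.2} := by
  set B := {x ∈ T.offDiag | t x.1 = t x.2} with hB
  have h1 : #(T \ B.image Prod.fst) ≤ #(T.image t) := by
    rw [← Finset.card_image_of_injOn (f := t)]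
    · exact Finset.card_le_card (Finset.image_subset_image Finset.sdiff_subset)
    · intro a ha b hb hab
      by_contra hne
      rw [Finset.mem_coe, Finset.mem_sdiff] at ha hb
      apply ha.2
      rw [Finset.mem_image]
      exact ⟨(a, b), by rw [hB, Finset.mem_filter, Finset.mem_offDiag]; exact
        ⟨⟨ha.1, hb.1, hne⟩, hab⟩, rfl⟩
  have h2 : #(B.image Prod.fst) ≤ #B := Finset.card_image_le
  have h3 := Finset.le_card_sdiff (B.image Prod.fst) T
  omega

/-- If distinct elements collide for at most one parameter, then some parameter is injective
enough for half of the sets. -/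
theorem exists_parameter_few_collisions {β α κ : Type*} [DecidableEq α] [DecidableEq κ] [Fintype κ]
    [DecidableEq β] (G : Finset β) (T : β → Finset α) (t : κ → β → α → κ) (n : ℕ) (hn : 0 < n)
    (hp : 3 * (12 * n) ≤ Fintype.card κ) (hT : ∀ g ∈ G, #(T g) = 12 * n)
    (hcol : ∀ g ∈ G, ∀ a ∈ T g, ∀ b ∈ T g, a ≠ b → ∀ c c' : κ, t c g a = t c g b →
      t c' g a = t c' g b → c = c') :
    ∃ c : κ, #G ≤ 2 * #{g ∈ G | 3 * n < #((T g).image (t c g))} := by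
  by_contra! hcon
  have hκ : 0 < Fintype.card κ := by omega
  obtain ⟨c0⟩ := Fintype.card_pos_iff.1 hκ
  have hG : 0 < #G := by have := hcon c0; omega
  let col : κ → β → ℕ := fun c g => #{x ∈ (T g).offDiag | t c g x.1 = t c g x.2}
  have h1 : ∀ c, 9 * n * #G ≤ 2 * ∑ g ∈ G, col c g := by
    intro c
    have hb := hcon c
    have hsplit := Finset.card_filter_add_card_filter_not (s := G)
      (fun g => 3 * n < #((T g).image (t c g)))
    have h2 : #{g ∈ G | ¬ 3 * n < #((T g).image (t c g))} * (9 * n) ≤ ∑ g ∈ G, col c g := by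
      rw [← smul_eq_mul]
      refine (Finset.card_nsmul_le_sum _ (col c) _ fun g hg => ?_).trans
        (Finset.sum_le_sum_of_subset (Finset.filter_subset _ _))
      rw [Finset.mem_filter] at hg
      have := card_le_card_image_add_collisions (T g) (t c g)
      have hc := hT g hg.1
      simp only [col]
      omega
    nlinarith
  have h2 : ∑ c, ∑ g ∈ G, col c g ≤ #G * (12 * n) ^ 2 := by
    rw [Finset.sum_comm, ← smul_eq_mul]
    refine Finset.sum_le_card_nsmul _ _ _ fun g hg => ?_
    calc ∑ c, col c g = ∑ c, ∑ x ∈ (T g).offDiag, if t c g x.1 = t c g x.2 then 1 else 0 := by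
          simp only [col, Finset.card_filter]
      _ = ∑ x ∈ (T g).offDiag, ∑ c, if t c g x.1 = t c g x.2 then 1 else 0 := Finset.sum_comm
      _ ≤ ∑ x ∈ (T g).offDiag, 1 := by
          refine Finset.sum_le_sum fun x hx => ?_
          rw [← Finset.card_filter, Finset.card_le_one]
          intro c hc c' hc'
          rw [Finset.mem_filter] at hc hc'
          rw [Finset.mem_offDiag] at hx
          exact hcol g hg x.1 hx.1 x.2 hx.2.1 hx.2.2 c c' hc.2 hc'.2
      _ ≤ (12 * n) ^ 2 := by
          rw [Finset.sum_const, smul_eq_mul, mul_one, Finset.offDiag_card, hT g hg, sq]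
          omega
  have h3 : Fintype.card κ * (9 * n * #G) ≤ ∑ c, 2 * ∑ g ∈ G, col c g := by
    rw [← smul_eq_mul, ← Finset.card_univ]
    exact Finset.card_nsmul_le_sum _ _ _ fun c _ => h1 c
  rw [← Finset.mul_sum] at h3
  have h4 : 3 * (12 * n) * (9 * n * #G) ≤ Fintype.card κ * (9 * n * #G) :=
    Nat.mul_le_mul_right _ hp
  have h5 : 0 < n * n * #G := by positivity
  nlinarith

section RichPairs
variable {p : ℕ} [Fact p.Prime]

/-- Many pairs `(y, w)` admit many pairs `(a, y')` with `(w - a) / y * y'` in a given set. -/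
theorem exists_many_rich_pairs {Y W B X U : Finset (ZMod p)} (hY : 0 ∉ Y)
    (hX : ∀ w ∈ W, ∀ a ∈ B, w - a ∈ X) (hU : ∀ x ∈ X, ∀ y ∈ Y, x / y ∈ U) (hUpos : 0 < #U) (n : ℕ)
    (hn : 192 * n * #U ≤ #B * (#Y * #W)) (hν : 4 * #U ≤ #Y * #W) :
    ∃ G ⊆ Y ×ˢ W, #Y * #W ≤ 4 * #G ∧ ∀ g ∈ G,
      12 * n ≤ #{x ∈ B ×ˢ Y | (g.2 - x.1) / g.1 * x.2 ∈ X ∧ g.1 * x.2 ≠ 1} := by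
  let ν : ZMod p → ℕ := fun u => #{y' ∈ Y | u * y' ∈ X}
  let pop : ZMod p → Prop := fun u => #Y * #W ≤ 2 * #U * ν u
  classical
  have h1 : 2 * #{x ∈ (Y ×ˢ W) ×ˢ B | ¬ pop ((x.1.2 - x.2) / x.1.1)} ≤ #B * (#Y * #W) := by
    have h2 : #{x ∈ (Y ×ˢ W) ×ˢ B | ¬ pop ((x.1.2 - x.2) / x.1.1)} ≤
        ∑ u ∈ U with ¬ pop u, #B * ν u := by
      rw [Finset.card_eq_sum_card_fiberwise (f := fun x => (x.1.2 - x.2) / x.1.1)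
        (t := {u ∈ U | ¬ pop u})]
      · refine Finset.sum_le_sum fun u _ => ?_
        refine le_of_le_of_eq ?_ (Finset.card_product B {y' ∈ Y | u * y' ∈ X})
        refine Finset.card_le_card_of_injOn (fun x => (x.2, x.1.1)) ?_ ?_
        · rintro ⟨⟨y, w⟩, a⟩ hx
          simp only [Finset.coe_filter, Set.mem_ofPred_eq, Finset.mem_filter,
            Finset.mem_product] at hx
          obtain ⟨⟨⟨⟨hy, hw⟩, ha⟩, -⟩, hu⟩ := hx
          have hy0 : y ≠ 0 := fun h => hY (h ▸ hy)
          simp only [Finset.coe_product, Set.mem_prod, Finset.mem_coe, Finset.mem_filter]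
          refine ⟨ha, hy, ?_⟩
          rw [← hu, div_mul_cancel₀ _ hy0]
          exact hX w hw a ha
        · rintro ⟨⟨y, w⟩, a⟩ hx ⟨⟨y1, w1⟩, a1⟩ hx1 h
          simp only [Finset.coe_filter, Set.mem_ofPred_eq, Finset.mem_filter,
            Finset.mem_product] at hx hx1
          obtain ⟨⟨⟨⟨hy, hw⟩, ha⟩, -⟩, hu⟩ := hx
          obtain ⟨-, hu1⟩ := hx1
          have hy0 : y ≠ 0 := fun h => hY (h ▸ hy)
          simp only [Prod.mk.injEq] at h
          obtain ⟨rfl, rfl⟩ := h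
          rw [← hu1, div_left_inj' hy0, sub_left_inj] at hu
          rw [hu]
      · rintro ⟨⟨y, w⟩, a⟩ hx
        simp only [Finset.coe_filter, Set.mem_ofPred_eq, Finset.mem_product] at hx ⊢
        exact ⟨hU _ (hX _ hx.1.1.2 _ hx.1.2) _ hx.1.1.1, hx.2⟩
    have h3 : 2 * #U * ∑ u ∈ U with ¬ pop u, #B * ν u ≤ #U * (#B * (#Y * #W)) := by
      rw [Finset.mul_sum]
      refine (Finset.sum_le_card_nsmul _ _ (#B * (#Y * #W)) fun u hu => ?_).trans ?_
      · rw [Finset.mem_filter] at hu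
        have := (not_le.1 hu.2).le
        calc 2 * #U * (#B * ν u) = #B * (2 * #U * ν u) := by ring
          _ ≤ _ := Nat.mul_le_mul_left _ this
      · rw [smul_eq_mul]
        exact Nat.mul_le_mul_right _ (Finset.card_filter_le _ _)
    refine Nat.le_of_mul_le_mul_left (le_trans ?_ h3) hUpos
    calc _ = 2 * #U * #{x ∈ (Y ×ˢ W) ×ˢ B | ¬ pop ((x.1.2 - x.2) / x.1.1)} := by ring
      _ ≤ _ := Nat.mul_le_mul_left _ h2
  let r : ZMod p × ZMod p → ℕ := fun g => #{a ∈ B | pop ((g.2 - a) / g.1)}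
  refine ⟨{g ∈ Y ×ˢ W | #B ≤ 4 * r g}, Finset.filter_subset _ _, ?_, ?_⟩
  · have h4 : #{x ∈ (Y ×ˢ W) ×ˢ B | pop ((x.1.2 - x.2) / x.1.1)} = ∑ g ∈ Y ×ˢ W, r g := by
      rw [Finset.card_filter, Finset.sum_product]
      simp only [r, Finset.card_filter]
    have h5 := Finset.card_filter_add_card_filter_not (s := (Y ×ˢ W) ×ˢ B)
      (fun x => pop ((x.1.2 - x.2) / x.1.1))
    rw [Finset.card_product, Finset.card_product] at h5
    have h6 : 4 * ∑ g ∈ Y ×ˢ W, r g ≤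
        #{g ∈ Y ×ˢ W | #B ≤ 4 * r g} * (4 * #B) + #(Y ×ˢ W) * #B := by
      rw [Finset.mul_sum, Finset.card_filter, Finset.sum_mul, ← smul_eq_mul (#(Y ×ˢ W)),
        ← Finset.sum_const, ← Finset.sum_add_distrib]
      refine Finset.sum_le_sum fun g _ => ?_
      have hr : r g ≤ #B := Finset.card_filter_le _ _
      split_ifs with h <;> omega
    rw [Finset.card_product] at h6
    rcases Nat.eq_zero_or_pos #B with hB | hB
    · simp only [hB, Nat.zero_le, Finset.filter_true]
      rw [Finset.card_product]; omega
    · refine Nat.le_of_mul_le_mul_left (c := #B) ?_ hB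
      nlinarith
  · rintro ⟨y, w⟩ hg
    rw [Finset.mem_filter, Finset.mem_product] at hg
    obtain ⟨⟨hy, hw⟩, hr⟩ := hg
    have hy0 : y ≠ 0 := fun h => hY (h ▸ hy)
    have h7 : ∑ a ∈ B with pop ((w - a) / y), (ν ((w - a) / y) - 1) ≤
        #{x ∈ B ×ˢ Y | (w - x.1) / y * x.2 ∈ X ∧ y * x.2 ≠ 1} := by
      rw [Finset.card_filter, Finset.sum_product]
      refine le_trans ?_ (Finset.sum_le_sum_of_subset (Finset.filter_subset
        (fun a => pop ((w - a) / y)) _))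
      refine Finset.sum_le_sum fun a _ => ?_
      rw [← Finset.card_filter]
      simp only [ν]
      refine (Finset.pred_card_le_card_erase (a := y⁻¹)).trans (Finset.card_le_card ?_)
      intro y' hy'
      rw [Finset.mem_erase, Finset.mem_filter] at hy'
      rw [Finset.mem_filter]
      refine ⟨hy'.2.1, hy'.2.2, fun h => hy'.1 (eq_inv_of_mul_eq_one_right h)⟩
    refine le_trans ?_ h7
    have h8 : ∀ a ∈ ({a ∈ B | pop ((w - a) / y)} : Finset (ZMod p)),
        #Y * #W ≤ 4 * #U * (ν ((w - a) / y) - 1) := by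
      intro a ha
      rw [Finset.mem_filter] at ha
      have ha2 : #Y * #W ≤ 2 * #U * ν ((w - a) / y) := ha.2
      have hν2 : 2 ≤ ν ((w - a) / y) := by
        by_contra! hlt
        have : 2 * #U * ν ((w - a) / y) ≤ 2 * #U * 1 := Nat.mul_le_mul_left _ (by omega)
        omega
      obtain ⟨m, hm⟩ := Nat.exists_eq_add_of_le hν2
      rw [hm] at ha2 ⊢
      have : 2 + m - 1 = m + 1 := by omega
      rw [this]
      nlinarith
    have h9 : r (y, w) * (#Y * #W) ≤
        4 * #U * ∑ a ∈ B with pop ((w - a) / y), (ν ((w - a) / y) - 1) := by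
      rw [Finset.mul_sum, ← smul_eq_mul]
      exact Finset.card_nsmul_le_sum _ _ _ h8
    have h10 : #B * (#Y * #W) ≤ 4 * r (y, w) * (#Y * #W) := Nat.mul_le_mul_right _ hr
    refine Nat.le_of_mul_le_mul_left (c := 16 * #U) ?_ (by omega)
    nlinarith

end RichPairs

section Incidence
open MvPolynomial
variable {p : ℕ} [Fact p.Prime]

set_option maxHeartbeats 1000000 in
open scoped Classical in
theorem exists_polynomial_vanishing_on_many_lines {Y W W' A B X U : Finset (ZMod p)} (hY : 0 ∉ Y)
    (hYne : Y.Nonempty) (hWne : W.Nonempty) (hAne : A.Nonempty)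
    (hX : ∀ w ∈ W, ∀ a ∈ B, w - a ∈ X) (hU : ∀ x ∈ X, ∀ y ∈ Y, x / y ∈ U)
    (hW' : ∀ x ∈ X, ∀ a ∈ A, a + x ∈ W') (hUpos : 0 < #U) (n : ℕ) (hn0 : 0 < n)
    (hn : 192 * n * #U ≤ #B * (#Y * #W)) (hν : 4 * #U ≤ #Y * #W)
    (hnM : #Y * (#W' * #B) * (3 * n) < n ^ 3) (hnp : 3 * (12 * n) ≤ p) :
    ∃ (κ : ZMod p) (F : MvPolynomial (Fin 3) (ZMod p)), F ≠ 0 ∧ 0 < totalDegree F ∧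
      totalDegree F < 3 * n ∧ #Y * #W * #A ≤
        8 * #{i ∈ Y ×ˢ W ×ˢ A | lineHom (lineBase κ i) (lineDir i) F = 0} := by
  obtain ⟨G, hGsub, hGcard, hG⟩ := exists_many_rich_pairs hY hX hU hUpos n hn hν
  have hT : ∀ g : ZMod p × ZMod p, ∃ T : Finset (ZMod p × ZMod p), g ∈ G →
      T ⊆ {x ∈ B ×ˢ Y | (g.2 - x.1) / g.1 * x.2 ∈ X ∧ g.1 * x.2 ≠ 1} ∧ #T = 12 * n := by
    intro g
    by_cases hg : g ∈ G
    · obtain ⟨T, h1, h2⟩ := Finset.exists_subset_card_eq (hG g hg)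
      exact ⟨T, fun _ => ⟨h1, h2⟩⟩
    · exact ⟨∅, fun h => absurd h hg⟩
  choose T hT using hT
  have hTmem : ∀ g ∈ G, ∀ x ∈ T g, g.1 ≠ 0 ∧ x.1 ∈ B ∧ x.2 ∈ Y ∧ x.2 ≠ 0 ∧
      (g.2 - x.1) / g.1 * x.2 ∈ X ∧ 1 - g.1 * x.2 ≠ 0 := by
    intro g hg x hx
    have h1 := (hT g hg).1 hx
    rw [Finset.mem_filter, Finset.mem_product] at h1
    exact ⟨fun h => hY (h ▸ (Finset.mem_product.1 (hGsub hg)).1), h1.1.1, h1.1.2,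
      fun h => hY (h ▸ h1.1.2), h1.2.1, fun h => h1.2.2 (sub_eq_zero.1 h).symm⟩
  let t : ZMod p → ZMod p × ZMod p → ZMod p × ZMod p → ZMod p := fun κ g x =>
    ((g.2 - x.1) / g.1 + κ) * x.2 / (1 - g.1 * x.2)
  obtain ⟨κ, hκ⟩ := exists_parameter_few_collisions G T t n hn0 (by rwa [ZMod.card])
    (fun g hg => (hT g hg).2) (by
      rintro ⟨y, w⟩ hg ⟨a, b⟩ hx ⟨a', b'⟩ hx' hne c c' h1 h2
      obtain ⟨hy, -, -, hb, -, hd⟩ := hTmem _ hg _ hx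
      obtain ⟨-, -, -, hb', -, hd'⟩ := hTmem _ hg _ hx'
      simp only [t] at h1 h2 hy hb hb' hd hd'
      rw [div_eq_div_iff hd hd'] at h1 h2
      have h3 : (c - c') * (b - b') = 0 := by linear_combination h1 - h2
      rcases mul_eq_zero.1 h3 with h | h
      · exact sub_eq_zero.1 h
      · exfalso
        have hbb : b = b' := sub_eq_zero.1 h
        subst hbb
        rw [mul_assoc, mul_assoc, mul_left_inj' (mul_ne_zero hb hd'), add_left_inj,
          div_left_inj' hy, sub_right_inj] at h1
        exact hne (by rw [h1]))
  obtain ⟨F, hF0, hFdeg, hF⟩ := exists_polynomial_vanishing_on_lines (Y ×ˢ W' ×ˢ B)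
    (fun i => ![i.2.1 + κ * i.1, 0, i.2.2]) (fun i => ![i.1 ^ 2, -i.1, 1]) n
    (by rwa [Finset.card_product, Finset.card_product])
  have hvan : ∀ g ∈ G, 3 * n < #((T g).image (t κ g)) → ∀ a ∈ A,
      lineHom (lineBase κ (g.1, g.2, a)) (lineDir (g.1, g.2, a)) F = 0 := by
    intro g hg hlt a' ha'
    refine Polynomial.eq_zero_of_natDegree_lt_card_of_eval_eq_zero' _ ((T g).image (t κ g)) ?_
      (lt_of_le_of_lt (natDegree_lineHom_le _ _ F) (by omega))
    intro τ hτ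
    rw [Finset.mem_image] at hτ
    obtain ⟨x, hx, rfl⟩ := hτ
    obtain ⟨hy, hxB, hxY, hb, hxX, hd⟩ := hTmem _ hg _ hx
    have hm := hF (x.2, a' + (g.2 - x.1) / g.1 * x.2, x.1)
      (Finset.mem_product.2 ⟨hxY, Finset.mem_product.2 ⟨hW' _ hxX _ ha', hxB⟩⟩)
    have hm' := congrArg (Polynomial.eval (g.1 * t κ g x / x.2)) hm
    rw [eval_lineHom, Polynomial.eval_zero] at hm'
    rw [eval_lineHom, ← hm']
    congr 2
    funext j
    fin_cases j
    · simp [lineBase, lineDir, t]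
      field_simp
      ring
    · simp [lineBase, lineDir, t]
      field_simp
    · simp [lineBase, lineDir, t]
      field_simp
      ring
  have hcount : #{g ∈ G | 3 * n < #((T g).image (t κ g))} * #A ≤
      #{i ∈ Y ×ˢ W ×ˢ A | lineHom (lineBase κ i) (lineDir i) F = 0} := by
    rw [← Finset.card_product]
    refine Finset.card_le_card_of_injOn (fun i => (i.1.1, i.1.2, i.2)) ?_ ?_
    · rintro ⟨g, a⟩ hi
      simp only [Finset.coe_product, Set.mem_prod, Finset.mem_coe, Finset.mem_filter] at hi
      simp only [Finset.coe_filter, Set.mem_ofPred_eq, Finset.mem_product]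
      have := Finset.mem_product.1 (hGsub hi.1.1)
      exact ⟨⟨this.1, this.2, hi.2⟩, hvan g hi.1.1 hi.1.2 a hi.2⟩
    · rintro ⟨⟨a, b⟩, c⟩ - ⟨⟨a', b'⟩, c'⟩ - h
      simp only [Prod.mk.injEq] at h ⊢
      tauto
  have hfinal : #Y * #W * #A ≤
      8 * #{i ∈ Y ×ˢ W ×ˢ A | lineHom (lineBase κ i) (lineDir i) F = 0} := by
    have : #Y * #W ≤ 8 * #{g ∈ G | 3 * n < #((T g).image (t κ g))} := by omega
    calc #Y * #W * #A ≤ 8 * #{g ∈ G | 3 * n < #((T g).image (t κ g))} * #A :=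
          Nat.mul_le_mul_right _ this
      _ ≤ _ := by rw [mul_assoc]; exact Nat.mul_le_mul_left _ hcount
  refine ⟨κ, F, hF0, ?_, hFdeg, hfinal⟩
  by_contra! h
  have hC := totalDegree_eq_zero_iff_eq_C.1 (Nat.le_zero.1 h)
  have hpos : 0 < #Y * #W * #A :=
    Nat.mul_pos (Nat.mul_pos hYne.card_pos hWne.card_pos) hAne.card_pos
  have : 0 < #{i ∈ Y ×ˢ W ×ˢ A | lineHom (lineBase κ i) (lineDir i) F = 0} :=
    (Nat.mul_pos_iff_of_pos_left (by norm_num : 0 < 8)).1 (hpos.trans_le hfinal)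
  obtain ⟨i, hi⟩ := Finset.card_pos.1 this
  have hi2 := (Finset.mem_filter.1 hi).2
  rw [hC, lineHom, algHom_C, map_eq_zero] at hi2
  exact hF0 (by rw [hC, hi2, C_0])

end Incidence

theorem degree_alternatives_absurd {y s a q k R : ℝ} (hy : 0 < y) (hs : 1 ≤ s) (ha : 0 < a)
    (hq : 0 < q) (hk : 1 ≤ k) (hR0 : 0 < R) (hqa : 442368 * k ^ 5 * q ≤ a)
    (hR : y * s * a ^ 3 ≤ R ^ 2 * (9216 * k ^ 3 * q)) (h2 : k ^ 2 * y * s ≤ 4 * a ^ 2)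
    (h3 : s ≤ 4 * k ^ 2 * y)
    (h : R ≤ 2 * a + s * a ∨ R * a ^ 2 ≤ 2 * (k ^ 2 * (y * s * a ^ 2)) ∨
      R ^ 2 ≤ 24 * (k ^ 2 * (y * s * a ^ 2))) : False := by
  have hk0 : 0 < k := by linarith
  have hs0 : 0 < s := by linarith
  have hc : 0 < 9216 * k ^ 3 * q := by positivity
  rcases h with h | h | h
  · have e1 : R ≤ 3 * (s * a) := by nlinarith
    have e2 : R ^ 2 ≤ (3 * (s * a)) ^ 2 := by gcongr
    have e3 : y * s * a ^ 3 ≤ (3 * (s * a)) ^ 2 * (9216 * k ^ 3 * q) :=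
      hR.trans (mul_le_mul_of_nonneg_right e2 hc.le)
    have e4 : (s * a ^ 2) * (y * a) ≤ (s * a ^ 2) * (82944 * k ^ 3 * q * s) := by
      linarith
    have e5 := le_of_mul_le_mul_left e4 (by positivity)
    have e6 : k ^ 2 * (y * a) ≤ k ^ 2 * (82944 * k ^ 3 * q * s) := by gcongr
    have e7 : 442368 * k ^ 5 * q * s ≤ a * s := by gcongr
    have e8 : a * (k ^ 2 * y) ≤ a * ((3 / 16) * s) := by linarith
    have e9 := le_of_mul_le_mul_left e8 ha
    have : 0 < k ^ 2 * y := by positivity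
    linarith
  · have e0 : R * a ^ 2 ≤ (2 * k ^ 2 * y * s) * a ^ 2 := by linarith
    have e1 := le_of_mul_le_mul_right e0 (by positivity)
    have e2 : R ^ 2 ≤ (2 * k ^ 2 * y * s) ^ 2 := by gcongr
    have e3 := hR.trans (mul_le_mul_of_nonneg_right e2 hc.le)
    have e4 : (y * s) * a ^ 3 ≤ (y * s) * (36864 * k ^ 7 * q * (y * s)) := by linarith
    have e5 := le_of_mul_le_mul_left e4 (by positivity)
    have e6 : 442368 * k ^ 5 * q * (k ^ 2 * y * s) ≤ a * (4 * a ^ 2) := by gcongr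
    have : 0 < a ^ 3 := by positivity
    linarith
  · have e3 := hR.trans (mul_le_mul_of_nonneg_right h hc.le)
    have e4 : (y * s * a ^ 2) * (442368 * k ^ 5 * q) ≤ (y * s * a ^ 2) * a := by gcongr
    have : 0 < y * s * a ^ 3 := by positivity
    linarith

section MainBound
variable {p : ℕ} [Fact p.Prime]

set_option maxHeartbeats 1000000 in
theorem card_mul_card_le_card_quotients_sq {Y S A U : Finset (ZMod p)} (hY : 0 ∉ Y)
    (hA : A.Nonempty) {K : ℝ} (hK1 : 1 ≤ K) (hK : (#(A + A) : ℝ) ≤ K * #A)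
    (hdir : #(S + A) = #S * #A)
    (hU : ∀ s ∈ S, ∀ a ∈ A, ∀ a' ∈ A, ∀ y ∈ Y, (s + a - a') / y ∈ U)
    (h1 : 442368 * K ^ 5 ≤ #A) (h2 : K ^ 2 * #Y * #S ≤ 4 * (#A : ℝ) ^ 2)
    (h3 : (#S : ℝ) ≤ 4 * K ^ 2 * #Y) (h4 : 20736 * ((#Y : ℝ) * #S * (#A : ℝ) ^ 2) ≤ (p : ℝ) ^ 2) :
    (#Y : ℝ) * #S * (#A : ℝ) ^ 2 ≤ 2 * 442368 * 768 ^ 2 * K ^ 8 * (#U : ℝ) ^ 2 := by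
  classical
  have hK0 : 0 < K := by linarith
  rcases Y.eq_empty_or_nonempty with rfl | hYne
  · simp; positivity
  rcases S.eq_empty_or_nonempty with rfl | hSne
  · simp; positivity
  have hy1 : (1 : ℝ) ≤ #Y := by exact_mod_cast hYne.card_pos
  have hs1 : (1 : ℝ) ≤ #S := by exact_mod_cast hSne.card_pos
  have ha1 : (1 : ℝ) ≤ #A := by exact_mod_cast hA.card_pos
  by_contra! hcon
  set q := ⌊(#A : ℝ) / (442368 * K ^ 5)⌋₊ with hq
  have hc0 : 0 < 442368 * K ^ 5 := by positivity
  have hqle : (q : ℝ) ≤ #A / (442368 * K ^ 5) := Nat.floor_le (by positivity)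
  have hqa : 442368 * K ^ 5 * q ≤ #A := by rwa [le_div_iff₀ hc0, mul_comm] at hqle
  have hq1 : 1 ≤ q := Nat.le_floor (by rw [le_div_iff₀ hc0]; simpa using h1)
  have hq1' : (1 : ℝ) ≤ q := by exact_mod_cast hq1
  have hqlt : (#A : ℝ) < 442368 * K ^ 5 * (2 * q) := by
    have h := Nat.lt_floor_add_one ((#A : ℝ) / (442368 * K ^ 5))
    rw [← hq, div_lt_iff₀ hc0] at h
    nlinarith
  have hK3 : 1 ≤ K ^ 3 := one_le_pow₀ hK1
  have hK5 : K ^ 3 ≤ K ^ 5 := pow_le_pow_right₀ hK1 (by norm_num)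
  have hKq : K ^ 3 * q ≤ #A := by nlinarith
  have hqA : (q : ℝ) ≤ #A := by nlinarith
  obtain ⟨B, hBA, hB⟩ := Finset.exists_subset_card_eq (Nat.cast_le.1 hqA)
  have hUK : 768 ^ 2 * K ^ 3 * (#U : ℝ) ^ 2 ≤ #Y * #S * #A * q := by
    have e1 : (442368 * K ^ 5 * 2) * (768 ^ 2 * K ^ 3 * (#U : ℝ) ^ 2) ≤
        (442368 * K ^ 5 * 2) * (#Y * #S * #A * q) := by
      calc _ = 2 * 442368 * 768 ^ 2 * K ^ 8 * (#U : ℝ) ^ 2 := by ring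
        _ ≤ (#Y : ℝ) * #S * #A * #A := by linarith
        _ ≤ (#Y : ℝ) * #S * #A * (442368 * K ^ 5 * (2 * q)) := by gcongr
        _ = _ := by ring
    exact le_of_mul_le_mul_left e1 (by positivity)
  set W' := S + (A + A - A) with hW'
  have hW'c : (#W' : ℝ) ≤ #S * (K ^ 3 * #A) := by
    have e1 : (#W' : ℝ) ≤ #S * #(A + A - A) := by exact_mod_cast Finset.card_add_le
    exact e1.trans (by gcongr; exact card_add_sub_le hA hK)
  have hW'ne : W'.Nonempty := hSne.add ((hA.add hA).sub hA)
  set M := #Y * (#W' * q) with hM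
  have hM1 : 1 ≤ M := Nat.mul_pos hYne.card_pos (Nat.mul_pos hW'ne.card_pos hq1)
  have hMle : (M : ℝ) ≤ K ^ 3 * (#Y * #S * #A * q) := by
    rw [hM]; push_cast
    calc (#Y : ℝ) * (#W' * q) ≤ #Y * (#S * (K ^ 3 * #A) * q) := by gcongr
      _ = _ := by ring
  set n := 2 * (Nat.sqrt M + 1) with hn
  have hsM := Nat.sqrt_le' M
  have hsM' := Nat.lt_succ_sqrt' M
  have hs1M : 1 ≤ Nat.sqrt M := Nat.le_sqrt'.2 (by simpa using hM1)
  have hn16 : n ^ 2 ≤ 16 * M := by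
    have : n ≤ 4 * Nat.sqrt M := by omega
    calc n ^ 2 ≤ (4 * Nat.sqrt M) ^ 2 := Nat.pow_le_pow_left this 2
      _ ≤ _ := by rw [mul_pow]; omega
  have hn16' : (n : ℝ) ^ 2 ≤ 16 * M := by exact_mod_cast hn16
  have hn0 : 0 < n := by omega
  have hnM : M * (3 * n) < n ^ 3 := by
    have : 3 * M < n ^ 2 := by
      rw [hn, mul_pow]
      rw [Nat.succ_eq_add_one] at hsM'
      omega
    calc M * (3 * n) = 3 * M * n := by ring
      _ < n ^ 2 * n := Nat.mul_lt_mul_of_pos_right this hn0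
      _ = n ^ 3 := by ring
  have hnU : 192 * n * #U ≤ q * (#Y * #(S + A)) := by
    rw [hdir]
    have : (192 * (n : ℝ) * #U) ^ 2 ≤ ((q : ℝ) * (#Y * (#S * #A))) ^ 2 := by
      calc (192 * (n : ℝ) * #U) ^ 2 = 192 ^ 2 * (n : ℝ) ^ 2 * (#U : ℝ) ^ 2 := by ring
        _ ≤ 192 ^ 2 * (16 * (K ^ 3 * (#Y * #S * #A * q))) * (#U : ℝ) ^ 2 := by
          gcongr; exact hn16'.trans (by gcongr)
        _ = (768 ^ 2 * K ^ 3 * (#U : ℝ) ^ 2) * (#Y * #S * #A * q) := by ring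
        _ ≤ ((#Y : ℝ) * #S * #A * q) * (#Y * #S * #A * q) := by gcongr
        _ = _ := by ring
    exact_mod_cast le_of_sq_le_sq this (by positivity)
  have hνU : 4 * #U ≤ #Y * #(S + A) := by
    rw [hdir]
    have : (4 * (#U : ℝ)) ^ 2 ≤ ((#Y : ℝ) * (#S * #A)) ^ 2 := by
      have hUU : (#U : ℝ) ^ 2 ≤ K ^ 3 * (#U : ℝ) ^ 2 := le_mul_of_one_le_left (by positivity) hK3
      have hys : (1 : ℝ) ≤ #Y * #S := by nlinarith
      calc (4 * (#U : ℝ)) ^ 2 ≤ 768 ^ 2 * K ^ 3 * (#U : ℝ) ^ 2 := by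
            rw [mul_pow, mul_assoc]
            gcongr
            norm_num
        _ ≤ (#Y : ℝ) * #S * #A * q := hUK
        _ ≤ (#Y : ℝ) * #S * #A * ((#Y * #S) * #A) := by
          gcongr
          exact hqA.trans (le_mul_of_one_le_left (by positivity) hys)
        _ = _ := by ring
    exact_mod_cast le_of_sq_le_sq this (by positivity)
  have hnp : 3 * (12 * n) ≤ p := by
    have : (3 * (12 * (n : ℝ))) ^ 2 ≤ (p : ℝ) ^ 2 := by
      refine le_trans ?_ h4
      calc (3 * (12 * (n : ℝ))) ^ 2 = 1296 * (n : ℝ) ^ 2 := by ring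
        _ ≤ 1296 * (16 * (K ^ 3 * (#Y * #S * #A * q))) := by
          gcongr; exact hn16'.trans (by gcongr)
        _ = 20736 * (#Y * #S * #A * (K ^ 3 * q)) := by ring
        _ ≤ 20736 * (#Y * #S * #A * #A) := by gcongr
        _ = _ := by ring
    exact_mod_cast le_of_sq_le_sq this (by positivity)
  have hUpos : 0 < #U := by
    obtain ⟨s, hs⟩ := hSne
    obtain ⟨a, ha⟩ := hA
    obtain ⟨y, hy⟩ := hYne
    exact Finset.card_pos.2 ⟨_, hU s hs a ha a ha y hy⟩
  obtain ⟨κ, F, hF0, hF1, hFn, hFc⟩ := exists_polynomial_vanishing_on_many_lines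
    (Y := Y) (W := S + A) (W' := W') (A := A) (B := B) (X := S + A - A) (U := U) hY hYne
    (hSne.add hA) hA (fun w hw a ha => Finset.sub_mem_sub hw (hBA ha))
    (fun x hx y hy => by
      obtain ⟨w, hw, a', ha', rfl⟩ := Finset.mem_sub.1 hx
      obtain ⟨s, hs, a, ha, rfl⟩ := Finset.mem_add.1 hw
      exact hU s hs a ha a' ha' y hy)
    (fun x hx a₀ ha₀ => by
      obtain ⟨w, hw, a', ha', rfl⟩ := Finset.mem_sub.1 hx
      obtain ⟨s, hs, a, ha, rfl⟩ := Finset.mem_add.1 hw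
      have : a₀ + (s + a - a') = s + (a₀ + a - a') := by ring
      rw [this]
      exact Finset.add_mem_add hs (Finset.sub_mem_sub (Finset.add_mem_add ha₀ ha) ha'))
    hUpos n hn0 (by rwa [hB]) hνU (by rwa [hB]) hnp
  have hnpos : (0 : ℝ) < n := by exact_mod_cast hn0
  set R : ℝ := (#Y * #S * (#A : ℝ) ^ 2) / (24 * n) with hR
  have hR0 : 0 < R := by positivity
  have hFc' : (#Y : ℝ) * #S * (#A : ℝ) ^ 2 ≤
      8 * (#{i ∈ Y ×ˢ (S + A) ×ˢ A | lineHom (lineBase κ i) (lineDir i) F = 0} : ℕ) := by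
    rw [hdir] at hFc
    have : ((#Y * (#S * #A) * #A : ℕ) : ℝ) ≤ (8 * (#{i ∈ Y ×ˢ (S + A) ×ˢ A |
      lineHom (lineBase κ i) (lineDir i) F = 0} : ℕ) : ℕ) := Nat.cast_le.2 hFc
    push_cast at this
    linarith
  have hFn' : (F.totalDegree : ℝ) ≤ 3 * n := by exact_mod_cast hFn.le
  have hRF : R * F.totalDegree ≤
      #{i ∈ Y ×ˢ (S + A) ×ˢ A | lineHom (lineBase κ i) (lineDir i) F = 0} := by
    have e1 : R * F.totalDegree ≤ R * (3 * n) := by gcongr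
    have e2 : R * (3 * n) = (#Y * #S * (#A : ℝ) ^ 2) / 8 := by
      rw [hR]; field_simp; norm_num
    linarith
  have halt := degree_alternatives hY hA κ hF0 hF1 (by omega) hR0 hRF
  have hP : (#Y : ℝ) * #(S + A + A) * #(A + A) ≤ K ^ 2 * (#Y * #S * (#A : ℝ) ^ 2) := by
    have e1 : (#(S + A + A) : ℝ) ≤ #S * (K * #A) := by
      rw [add_assoc]
      have : (#(S + (A + A)) : ℝ) ≤ #S * #(A + A) := by exact_mod_cast Finset.card_add_le
      exact this.trans (by gcongr)
    calc (#Y : ℝ) * #(S + A + A) * #(A + A) ≤ #Y * (#S * (K * #A)) * (K * #A) := by gcongr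
      _ = _ := by ring
  refine degree_alternatives_absurd (y := #Y) (s := #S) (a := #A) (q := q) (k := K) (R := R)
    (by linarith) hs1 (by linarith) (by linarith) hK1 hR0 hqa ?_ h2 h3 ?_
  · have e1 : (n : ℝ) ^ 2 * #A ≤ 16 * (K ^ 3 * (#Y * #S * #A * q)) * #A := by
      gcongr; exact hn16'.trans (by gcongr)
    rw [hR, div_pow, div_mul_eq_mul_div, le_div_iff₀ (by positivity)]
    have e2 : (#Y * #S * (#A : ℝ) ^ 2) * 576 * ((n : ℝ) ^ 2 * #A) ≤
      (#Y * #S * (#A : ℝ) ^ 2) * 576 * (16 * (K ^ 3 * (#Y * #S * #A * q)) * #A) := by gcongr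
    linarith
  · rcases halt with h | h | h
    · left
      rw [hdir] at h
      push_cast at h
      exact h
    · right; left
      linarith
    · right; right
      linarith

end MainBound

section Residues
variable {p : ℕ} [Fact p.Prime]

theorem quadraticChar_eq_one_of_mem_quadRes {x : ZMod p} (hx : x ∈ quadRes p) :
    quadraticChar (ZMod p) x = 1 := by
  obtain ⟨y, hy, rfl⟩ := (Finset.mem_filter.1 hx).2
  exact quadraticChar_sq_one' hy

theorem zero_notMem_quadRes : (0 : ZMod p) ∉ quadRes p := by
  intro h
  obtain ⟨y, hy, h0⟩ := (Finset.mem_filter.1 h).2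
  exact hy (pow_eq_zero_iff (two_ne_zero)|>.1 h0)

theorem mem_quadRes_of_mem {S A : Finset (ZMod p)}
    (hR : S + (A + A + A + A - A - A - A - A) ⊆ quadRes p) {s a₁ a₂ a₃ a₄ b₁ b₂ b₃ b₄ : ZMod p}
    (hs : s ∈ S) (h₁ : a₁ ∈ A) (h₂ : a₂ ∈ A) (h₃ : a₃ ∈ A) (h₄ : a₄ ∈ A) (k₁ : b₁ ∈ A)
    (k₂ : b₂ ∈ A) (k₃ : b₃ ∈ A) (k₄ : b₄ ∈ A) :
    s + (a₁ + a₂ + a₃ + a₄ - b₁ - b₂ - b₃ - b₄) ∈ quadRes p :=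
  hR (Finset.add_mem_add hs (Finset.sub_mem_sub (Finset.sub_mem_sub (Finset.sub_mem_sub
    (Finset.sub_mem_sub (Finset.add_mem_add (Finset.add_mem_add (Finset.add_mem_add h₁ h₂) h₃) h₄)
      k₁) k₂) k₃) k₄))

theorem card_add_eq_of_direct {S A : Finset (ZMod p)} (hA : A.Nonempty)
    (hdir : #(S + (A + A + A + A - A - A - A - A)) =
      #S * #(A + A + A + A - A - A - A - A)) : #(S + A) = #S * #A := by
  obtain ⟨c, hc⟩ := hA
  rw [Finset.card_add_iff] at hdir ⊢
  rintro ⟨s, a⟩ h ⟨s', a'⟩ h' heq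
  simp only [Set.mem_prod, Finset.mem_coe] at h h'
  have hmem : ∀ a ∈ A, a + c + c + c - c - c - c - c ∈ A + A + A + A - A - A - A - A := fun a ha =>
    Finset.sub_mem_sub (Finset.sub_mem_sub (Finset.sub_mem_sub
      (Finset.sub_mem_sub (Finset.add_mem_add (Finset.add_mem_add (Finset.add_mem_add ha hc) hc) hc)
      hc) hc) hc) hc
  have := @hdir (s, a + c + c + c - c - c - c - c)
    (Set.mem_prod.2 ⟨Finset.mem_coe.2 h.1, Finset.mem_coe.2 (hmem a h.2)⟩)
    (s', a' + c + c + c - c - c - c - c)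
    (Set.mem_prod.2 ⟨Finset.mem_coe.2 h'.1, Finset.mem_coe.2 (hmem a' h'.2)⟩)
    (by simp only at heq ⊢; linear_combination heq)
  simpa using this

theorem card_mul_card_le_of_log_le (hp2 : p ≠ 2) {S A : Finset (ZMod p)} (hA : A.Nonempty)
    (hdir : #(S + A) = #S * #A) (hR : S + (A + A + A + A - A - A - A - A) ⊆ quadRes p)
    (hlog : Nat.log 2 p ≤ #A) : (#S : ℝ) * #A ≤ 23 * Nat.log 2 p * √p := by
  obtain ⟨D, hDA, hD⟩ := Finset.exists_subset_card_eq hlog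
  obtain ⟨c, hc⟩ := hA
  have h := card_le_of_quadraticChar_const hp2 D ((S + A).image fun x => x - c - c) hD 1 (Or.inl rfl)
    (by
      intro u hu d hd
      obtain ⟨x, hx, rfl⟩ := Finset.mem_image.1 hu
      obtain ⟨s, hs, a, ha, rfl⟩ := Finset.mem_add.1 hx
      have := mem_quadRes_of_mem hR hs ha (hDA hd) hc hc hc hc hc hc
      have e : s + a - c - c + d = s + (a + d + c + c - c - c - c - c) := by ring
      rw [e]
      exact quadraticChar_eq_one_of_mem_quadRes this)
  rw [Finset.card_image_of_injective _ (fun a b h => by simpa using h), hdir] at h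
  exact_mod_cast h

theorem exists_quotients_card_le (hp2 : p ≠ 2) {S A Y : Finset (ZMod p)} (hA : A.Nonempty)
    (hR : S + (A + A + A + A - A - A - A - A) ⊆ quadRes p) (hY0 : 0 ∉ Y)
    (hY : ∀ y ∈ Y, ∀ j : ℕ, j < Nat.log 2 p → (j : ZMod p) * y ∈ A + A - A - A) :
    ∃ U : Finset (ZMod p), (∀ s ∈ S, ∀ a ∈ A, ∀ a' ∈ A, ∀ y ∈ Y, (s + a - a') / y ∈ U) ∧
      (#U : ℝ) ≤ 46 * Nat.log 2 p * √p := by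
  obtain ⟨c, hc⟩ := hA
  set D : Finset (ZMod p) := (Finset.range (Nat.log 2 p)).image (fun j : ℕ => (j : ZMod p)) with hDdef
  have hlt : Nat.log 2 p < p := Nat.log_lt_self 2 (Fact.out : p.Prime).ne_zero
  have hD : #D = Nat.log 2 p := by
    rw [hDdef, Finset.card_image_of_injOn, Finset.card_range]
    intro i hi j hj hij
    simp only [Finset.coe_range, Set.mem_Iio] at hi hj
    have := (ZMod.natCast_eq_natCast_iff' i j p).1 hij
    rwa [Nat.mod_eq_of_lt (by omega), Nat.mod_eq_of_lt (by omega)] at this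
  let Q : ℤ → Finset (ZMod p) := fun e =>
    (S ×ˢ A ×ˢ A ×ˢ {y ∈ Y | quadraticChar (ZMod p) y = e}).image
      fun x => (x.1 + x.2.1 - x.2.2.1) / x.2.2.2
  have hQ : ∀ e : ℤ, e = 1 ∨ e = -1 → (#(Q e) : ℝ) ≤ 23 * Nat.log 2 p * √p := by
    intro e he
    refine card_le_of_quadraticChar_const hp2 D (Q e) hD e he ?_
    intro u hu d hd
    obtain ⟨j, hj, rfl⟩ := Finset.mem_image.1 hd
    obtain ⟨⟨s, a, a', y⟩, hx, rfl⟩ := Finset.mem_image.1 hu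
    simp only [Finset.mem_product, Finset.mem_filter] at hx
    obtain ⟨hs, ha, ha', hy, hye⟩ := hx
    have hy0 : y ≠ 0 := fun h => hY0 (h ▸ hy)
    obtain ⟨v, hv, b₂, hb₂, e1⟩ := Finset.mem_sub.1 (hY y hy j (Finset.mem_range.1 hj))
    obtain ⟨w, hw, b₁, hb₁, rfl⟩ := Finset.mem_sub.1 hv
    obtain ⟨a₁, ha₁, a₂, ha₂, rfl⟩ := Finset.mem_add.1 hw
    have hm := quadraticChar_eq_one_of_mem_quadRes
      (mem_quadRes_of_mem hR hs ha ha₁ ha₂ hc ha' hb₁ hb₂ hc)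
    have e2 : s + (a + a₁ + a₂ + c - a' - b₁ - b₂ - c) = ((s + a - a') / y + j) * y := by
      rw [add_mul, div_mul_cancel₀ _ hy0, ← e1]
      ring
    rw [e2, map_mul, hye] at hm
    rcases he with rfl | rfl
    · simpa using hm
    · simp only
      linarith
  refine ⟨Q 1 ∪ Q (-1), ?_, ?_⟩
  · intro s hs a ha a' ha' y hy
    have hy0 : y ≠ 0 := fun h => hY0 (h ▸ hy)
    rw [Finset.mem_union]
    rcases quadraticChar_dichotomy hy0 with h | h
    · left
      exact Finset.mem_image.2 ⟨(s, a, a', y), Finset.mem_product.2 ⟨hs, Finset.mem_product.2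
        ⟨ha, Finset.mem_product.2 ⟨ha', Finset.mem_filter.2 ⟨hy, h⟩⟩⟩⟩, rfl⟩
    · right
      exact Finset.mem_image.2 ⟨(s, a, a', y), Finset.mem_product.2 ⟨hs, Finset.mem_product.2
        ⟨ha, Finset.mem_product.2 ⟨ha', Finset.mem_filter.2 ⟨hy, h⟩⟩⟩⟩, rfl⟩
  · have h1 := hQ 1 (Or.inl rfl)
    have h2 := hQ (-1) (Or.inr rfl)
    have h3 : (#(Q 1 ∪ Q (-1)) : ℝ) ≤ #(Q 1) + #(Q (-1)) := by
      exact_mod_cast Finset.card_union_le _ _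
    linarith

theorem three_halves_le_doubling {S A : Finset (ZMod p)} (hS : S.Nonempty) (hA : 2 ≤ #A)
    (hR : S + (A + A + A + A - A - A - A - A) ⊆ quadRes p) {K : ℝ}
    (hK : (#(A + A) : ℝ) ≤ K * #A) : 3 / 2 ≤ K := by
  have hAne : A.Nonempty := Finset.card_pos.1 (by omega)
  obtain ⟨c, hc⟩ := hAne
  obtain ⟨s, hs⟩ := hS
  have hne : A + A ≠ Finset.univ := by
    intro h
    have h1 : -s + c + c ∈ A + A := h ▸ Finset.mem_univ _
    obtain ⟨a, ha, b, hb, hab⟩ := Finset.mem_add.1 h1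
    have := mem_quadRes_of_mem hR hs ha hb hc hc hc hc hc hc
    have e : s + (a + b + c + c - c - c - c - c) = 0 := by
      linear_combination hab
    exact zero_notMem_quadRes (e ▸ this)
  have hlt : #(A + A) < p := by
    have := Finset.card_lt_card (Finset.ssubset_univ_iff.2 hne)
    rwa [Finset.card_univ, ZMod.card] at this
  have hcd := ZMod.cauchy_davenport (Fact.out : p.Prime) ⟨c, hc⟩ ⟨c, hc⟩ (s := A) (t := A)
  have h2 : 2 * #A ≤ #(A + A) + 1 := by omega
  have h2' : (2 * #A : ℝ) ≤ #(A + A) + 1 := by exact_mod_cast h2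
  have hA' : (2 : ℝ) ≤ #A := by exact_mod_cast hA
  nlinarith

end Residues

section Assembly
variable {p : ℕ} [Fact p.Prime]

set_option maxHeartbeats 1000000 in
theorem card_mul_card_pow_three_le (hp2 : p ≠ 2) {S A : Finset (ZMod p)} (hS : S.Nonempty)
    (hA : A.Nonempty) {K : ℝ} (hK1 : 1 ≤ K) (hK : (#(A + A) : ℝ) ≤ K * #A)
    (hdir : #(S + (A + A + A + A - A - A - A - A)) = #S * #(A + A + A + A - A - A - A - A))
    (hR : S + (A + A + A + A - A - A - A - A) ⊆ quadRes p) {l m : ℕ} (hl : 1 ≤ l)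
    (hm : 64 * (l : ℝ) ^ 2 * Real.log (4 * K ^ 3) ≤ m) (hlog : Nat.log 2 p ≤ 2 ^ l) {E : ℝ}
    (hE : 2 ^ 60 ≤ E) (hkE : (Nat.log 2 p : ℝ) ≤ E) (hKE : K ≤ E)
    (hME : (2 * K ^ m) ^ (l + 1) * K ^ (3 * l ^ 2) ≤ E) :
    (#S : ℝ) * (#A : ℝ) ^ 3 ≤ p * E ^ 14 := by
  have hE1 : 1 ≤ E := le_trans (by norm_num) hE
  have hE0 : 0 < E := by linarith
  have hp0 : (0 : ℝ) ≤ p := Nat.cast_nonneg p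
  have hSp : (#S : ℝ) ≤ p := by
    have := Finset.card_le_univ S
    rw [ZMod.card] at this
    exact_mod_cast this
  have hS1 : (1 : ℝ) ≤ #S := by exact_mod_cast hS.card_pos
  have hA1 : (1 : ℝ) ≤ #A := by exact_mod_cast hA.card_pos
  rcases lt_or_ge #A (Nat.log 2 p) with hAk | hAk
  · have h1 : (#A : ℝ) ≤ E := le_trans (by exact_mod_cast hAk.le) hkE
    calc (#S : ℝ) * (#A : ℝ) ^ 3 ≤ p * E ^ 3 := by gcongr
      _ ≤ p * E ^ 14 := by gcongr; norm_num
  have hdirA := card_add_eq_of_direct hA hdir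
  have hSA := card_mul_card_le_of_log_le hp2 hA hdirA hR hAk
  have hP2 : √(p : ℝ) ^ 2 = p := Real.sq_sqrt hp0
  have hP0 : 0 ≤ √(p : ℝ) := Real.sqrt_nonneg _
  set P : ℝ := √(p : ℝ) with hPdef
  have hSA' : (#S : ℝ) * #A ≤ E ^ 2 * P := hSA.trans <| by
    rw [sq]
    gcongr
    linarith
  rcases le_or_gt ((#A : ℝ) ^ 4) (p * E ^ 24) with hA4 | hA4
  · have h1 : (#A : ℝ) ^ 2 ≤ P * E ^ 12 := by
      refine (pow_le_pow_iff_left₀ (by positivity) (by positivity) two_ne_zero).1 ?_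
      rw [mul_pow, hP2, ← pow_mul, ← pow_mul]
      exact hA4
    calc (#S : ℝ) * (#A : ℝ) ^ 3 = (#S * #A) * (#A : ℝ) ^ 2 := by ring
      _ ≤ (E ^ 2 * P) * (P * E ^ 12) := by gcongr
      _ = P ^ 2 * E ^ 14 := by ring
      _ = p * E ^ 14 := by rw [hP2]
  have hA2 : P * E ^ 12 < (#A : ℝ) ^ 2 := by
    refine lt_of_pow_lt_pow_left₀ 2 (by positivity) ?_
    rw [mul_pow, hP2, ← pow_mul, ← pow_mul]
    exact hA4
  have hAP : (#A : ℝ) ≤ E ^ 2 * P := by nlinarith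
  have hPpos : 0 < P := by
    by_contra h
    have : P = 0 := by linarith
    rw [this] at hAP
    linarith
  have hPE : E ^ 8 ≤ P := by
    have h1 : P * E ^ 12 ≤ (E ^ 2 * P) ^ 2 := hA2.le.trans (by gcongr)
    have h2 : (P * E ^ 4) * E ^ 8 ≤ (P * E ^ 4) * P := by linarith
    exact le_of_mul_le_mul_left h2 (by positivity)
  have hAE : E ^ 10 ≤ #A := by
    refine (pow_le_pow_iff_left₀ (by positivity) (by positivity) two_ne_zero).1 ?_
    calc (E ^ 10) ^ 2 = E ^ 8 * E ^ 12 := by ring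
      _ ≤ P * E ^ 12 := by gcongr
      _ ≤ _ := hA2.le
  obtain ⟨Y, hYA, hAY, hY⟩ := exists_progression_differences hp2 hA hK1 hK m l hl hm
  have hAY' : (#A : ℝ) ≤ E * #Y := hAY.trans (by rw [mul_comm]; gcongr)
  have hYE : E ^ 9 ≤ #Y := by
    have : E * E ^ 9 ≤ E * #Y := by
      calc E * E ^ 9 = E ^ 10 := by ring
        _ ≤ _ := hAE.trans hAY'
    exact le_of_mul_le_mul_left this hE0
  have hY2 : (2 : ℝ) ≤ #Y := by
    have : E ≤ E ^ 9 := le_self_pow₀ hE1 (by norm_num)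
    linarith
  have hYe : (#Y : ℝ) ≤ 2 * #(Y.erase 0) := by
    have h1 : #Y ≤ #(Y.erase 0) + 1 := by
      have := Finset.pred_card_le_card_erase (s := Y) (a := 0)
      omega
    have h1' : (#Y : ℝ) ≤ #(Y.erase 0) + 1 := by exact_mod_cast h1
    linarith
  have hYA' : (#(Y.erase 0) : ℝ) ≤ #A := by
    exact_mod_cast (Finset.card_erase_le).trans hYA
  obtain ⟨U, hU, hUcard⟩ := exists_quotients_card_le (Y := Y.erase 0) hp2 hA hR
    (Finset.notMem_erase 0 Y)
    (fun y hy j hj => hY y (Finset.mem_of_mem_erase hy) j (hj.trans_le hlog))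
  have hUE : (#U : ℝ) ≤ 46 * E * P := hUcard.trans (by gcongr)
  have hZ0 := Finset.notMem_erase 0 Y
  generalize (Y.erase 0) = Z at *
  have hAZ : (#A : ℝ) ≤ 2 * E * #Z := by nlinarith
  have hAP2 : E ^ 4 * P ≤ (#A : ℝ) ^ 2 := by
    have : E ^ 4 ≤ E ^ 12 := by gcongr; norm_num
    nlinarith
  have hmain : (#Z : ℝ) * #S * (#A : ℝ) ^ 2 ≤ 2 * 442368 * 768 ^ 2 * K ^ 8 * (#U : ℝ) ^ 2 := by
    refine card_mul_card_le_card_quotients_sq hZ0 hA hK1 hK hdirA hU ?_ ?_ ?_ ?_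
    · calc 442368 * K ^ 5 ≤ E * E ^ 5 := by gcongr; linarith
        _ = E ^ 6 := by ring
        _ ≤ E ^ 10 := by gcongr; norm_num
        _ ≤ #A := hAE
    · calc K ^ 2 * #Z * #S ≤ E ^ 2 * #A * #S := by gcongr
        _ = E ^ 2 * (#S * #A) := by ring
        _ ≤ E ^ 2 * (E ^ 2 * P) := by gcongr
        _ = E ^ 4 * P := by ring
        _ ≤ (#A : ℝ) ^ 2 := hAP2
        _ ≤ 4 * (#A : ℝ) ^ 2 := by linarith [sq_nonneg (#A : ℝ)]
    · have h1 : (#S * E ^ 10 : ℝ) * #A ≤ #A * #A := by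
        calc (#S * E ^ 10 : ℝ) * #A = E ^ 10 * (#S * #A) := by ring
          _ ≤ E ^ 10 * (E ^ 2 * P) := by gcongr
          _ = P * E ^ 12 := by ring
          _ ≤ #A * #A := by rw [← sq]; exact hA2.le
      have h2 : (#S * E ^ 10 : ℝ) ≤ #A := le_of_mul_le_mul_right h1 (by linarith)
      have h3 : E * #S ≤ E * (2 * #Z) := by
        calc E * #S ≤ E ^ 10 * #S := by gcongr; exact le_self_pow₀ hE1 (by norm_num)
          _ = #S * E ^ 10 := by ring
          _ ≤ 2 * E * #Z := h2.trans hAZ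
          _ = E * (2 * #Z) := by ring
      have h4 : (#S : ℝ) ≤ 2 * #Z := le_of_mul_le_mul_left h3 hE0
      have h5 : (1 : ℝ) ≤ K ^ 2 := one_le_pow₀ hK1
      nlinarith [(Nat.cast_nonneg #Z : (0 : ℝ) ≤ #Z)]
    · calc 20736 * ((#Z : ℝ) * #S * (#A : ℝ) ^ 2)
          ≤ E * (#A * #S * (#A : ℝ) ^ 2) := by gcongr; linarith
        _ = E * ((#S * #A) * (#A : ℝ) ^ 2) := by ring
        _ ≤ E * ((E ^ 2 * P) * (E ^ 2 * P) ^ 2) := by gcongr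
        _ = E ^ 7 * P ^ 3 := by ring
        _ ≤ E ^ 8 * P ^ 3 := by gcongr; norm_num
        _ ≤ P * P ^ 3 := by gcongr
        _ = (P ^ 2) ^ 2 := by ring
        _ = (p : ℝ) ^ 2 := by rw [hP2]
  calc (#S : ℝ) * (#A : ℝ) ^ 3 = #A * (#S * (#A : ℝ) ^ 2) := by ring
    _ ≤ (2 * E * #Z) * (#S * (#A : ℝ) ^ 2) := by gcongr
    _ = 2 * E * (#Z * #S * (#A : ℝ) ^ 2) := by ring
    _ ≤ 2 * E * (2 * 442368 * 768 ^ 2 * E ^ 8 * (46 * E * P) ^ 2) := by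
      refine mul_le_mul_of_nonneg_left (hmain.trans ?_) (by positivity)
      gcongr
    _ = (2 * (2 * 442368 * 768 ^ 2 * 46 ^ 2)) * (E ^ 11 * P ^ 2) := by ring
    _ ≤ E * (E ^ 11 * P ^ 2) := by gcongr; linarith
    _ = E ^ 12 * P ^ 2 := by ring
    _ ≤ E ^ 14 * P ^ 2 := by gcongr; norm_num
    _ = p * E ^ 14 := by rw [hP2, mul_comm]

theorem le_exp_of_logb_two_le {x t : ℝ} (hx : 0 < x) (ht : 0 ≤ t) (h : Real.logb 2 x ≤ t) :
    x ≤ Real.exp t := by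
  calc x = 2 ^ Real.logb 2 x := (Real.rpow_logb (by norm_num) (by norm_num) hx).symm
    _ ≤ 2 ^ t := Real.rpow_le_rpow_of_exponent_le (by norm_num) h
    _ ≤ Real.exp 1 ^ t := Real.rpow_le_rpow (by norm_num)
      (by linarith [Real.exp_one_gt_d9]) ht
    _ = Real.exp t := by rw [← Real.exp_mul, one_mul]

theorem half_le_logb_two {x : ℝ} (hx : 3 / 2 ≤ x) : 1 / 2 ≤ Real.logb 2 x := by
  rw [Real.le_logb_iff_rpow_le (by norm_num) (by linarith), ← Real.sqrt_eq_rpow]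
  exact (Real.sqrt_le_iff.2 ⟨by norm_num, by norm_num⟩).trans hx

/-- The loss in the progression-finding step, with `L = log log p` and `K` the doubling. -/
theorem progression_loss_le {K L : ℝ} (hL : 1 / 2 ≤ L) (hK : 3 / 2 ≤ K) {l m : ℕ} (hl : l = ⌈L⌉₊)
    (hm : m = ⌈64 * (l : ℝ) ^ 2 * Real.log (4 * K ^ 3)⌉₊) :
    (2 * K ^ m) ^ (l + 1) * K ^ (3 * l ^ 2) ≤
      Real.exp (20400 * (L ^ 3 * (Real.logb 2 K) ^ 2)) := by
  have hK0 : 0 < K := by linarith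
  have hlam : 1 / 2 ≤ Real.logb 2 K := half_le_logb_two hK
  have hlogK : Real.log K = Real.log 2 * Real.logb 2 K := by
    rw [Real.logb, mul_div_cancel₀ _ (Real.log_pos (by norm_num)).ne']
  have hlog4 : Real.log (4 * K ^ 3) = Real.log 2 * (2 + 3 * Real.logb 2 K) := by
    rw [Real.log_mul (by norm_num) (by positivity), Real.log_pow, hlogK,
      show (4 : ℝ) = 2 ^ 2 by norm_num, Real.log_pow]
    push_cast
    ring
  refine le_exp_of_logb_two_le (by positivity) (by positivity) ?_
  rw [Real.logb_mul (by positivity) (by positivity), Real.logb_pow, Real.logb_pow,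
    Real.logb_mul (by positivity) (by positivity), Real.logb_pow,
    Real.logb_self_eq_one (by norm_num)]
  have hlL : (l : ℝ) ≤ 3 * L := by
    have := Nat.ceil_lt_add_one (show 0 ≤ L by linarith)
    rw [← hl] at this
    linarith
  have hlog0 : 0 ≤ Real.log (4 * K ^ 3) := by
    rw [hlog4]
    have := Real.log_pos (show (1 : ℝ) < 2 by norm_num)
    positivity
  have hlogle : Real.log (4 * K ^ 3) ≤ 4.9 * Real.logb 2 K := by
    rw [hlog4]
    have := Real.log_two_lt_d9
    nlinarith
  have hmL : (m : ℝ) ≤ 64 * (3 * L) ^ 2 * (4.9 * Real.logb 2 K) + 1 := by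
    have := Nat.ceil_lt_add_one (show 0 ≤ 64 * (l : ℝ) ^ 2 * Real.log (4 * K ^ 3) by positivity)
    rw [← hm] at this
    refine this.le.trans ?_
    gcongr
  generalize Real.logb 2 K = t at *
  have hLt : 1 / 4 ≤ L * t := by nlinarith
  push_cast
  have hL2 : 1 / 4 ≤ L ^ 2 := by nlinarith
  have hL2t : 1 / 8 ≤ L ^ 2 * t := by nlinarith
  have hL2t2 : 1 / 16 ≤ L ^ 2 * t ^ 2 := by nlinarith
  have hcube : L ^ 2 * t ≤ 4 * (L ^ 3 * t ^ 2) := by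
    have : (L ^ 2 * t) * 1 ≤ (L ^ 2 * t) * (4 * (L * t)) := by gcongr; linarith
    linarith
  have h1 : (1 + m * t : ℝ) ≤ 2847 * (L ^ 2 * t ^ 2) := by
    have : (m : ℝ) * t ≤ (2831 * (L ^ 2 * t)) * t := by gcongr; linarith
    linarith
  have h2 : ((l : ℝ) + 1) * (1 + m * t) ≤ (5 * L) * (2847 * (L ^ 2 * t ^ 2)) := by
    gcongr
    linarith
  have h3 : 3 * (l : ℝ) ^ 2 * t ≤ 3 * (3 * L) ^ 2 * t := by gcongr
  have h4 : 0 ≤ L ^ 3 * t ^ 2 := by positivity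
  linarith

end Assembly

theorem stmt13 :
    ∃ C : ℝ, 0 < C ∧
      ∀ (p : ℕ) [Fact p.Prime],
        0 < Real.logb 2 (Real.logb 2 p) →
        ∀ (A : Finset (ZMod p)) (K : ℝ),
          A.Nonempty → 1 ≤ K →
          ((A + A).card : ℝ) ≤ K * A.card →
          ∀ S : Finset (ZMod p),
            (S + (A + A + A + A - A - A - A - A)).card
              = S.card * (A + A + A + A - A - A - A - A).card →
            S + (A + A + A + A - A - A - A - A) ⊆ quadRes p →
            (S.card : ℝ) ≤ C * ((p : ℝ) / (A.card : ℝ) ^ 3) *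
              Real.exp (C * (Real.logb 2 (Real.logb 2 p)) ^ 3 * (Real.logb 2 K) ^ 2) := by
  refine ⟨285600, by norm_num, ?_⟩
  intro p _ hLL A K hA hK1 hK S hdir hR
  rcases S.eq_empty_or_nonempty with rfl | hS
  · simp only [Finset.card_empty, Nat.cast_zero]
    positivity
  have hpp : p.Prime := Fact.out
  have hp2 : p ≠ 2 := by
    rintro rfl
    simp at hLL
  have hp3 : (3 : ℝ) ≤ p := by
    have := hpp.two_le
    exact_mod_cast (show 3 ≤ p by omega)
  have hL1 : 3 / 2 ≤ Real.logb 2 p := by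
    rw [Real.le_logb_iff_rpow_le (by norm_num) (by linarith)]
    refine le_trans ?_ hp3
    refine (pow_le_pow_iff_left₀ (by positivity) (by positivity) two_ne_zero).1 ?_
    rw [← Real.rpow_natCast, ← Real.rpow_mul (by norm_num)]
    norm_num
  have hLL1 : 1 / 2 ≤ Real.logb 2 (Real.logb 2 p) := half_le_logb_two hL1
  have hk : (Nat.log 2 p : ℝ) ≤ Real.logb 2 p := Real.natLog_le_logb p 2
  have hpow : Real.logb 2 p = 2 ^ Real.logb 2 (Real.logb 2 p) :=
    (Real.rpow_logb (by norm_num) (by norm_num) (by linarith)).symm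
  have hSp : (#S : ℝ) ≤ p := by
    have := Finset.card_le_univ S
    rw [ZMod.card] at this
    exact_mod_cast this
  rcases (Nat.succ_le_of_lt hA.card_pos).eq_or_lt with hA1 | hA2
  · have h1 : (#A : ℝ) = 1 := by exact_mod_cast hA1.symm
    have h2 : 1 ≤ Real.exp (285600 * Real.logb 2 (Real.logb 2 p) ^ 3 * Real.logb 2 K ^ 2) :=
      Real.one_le_exp (by positivity)
    rw [h1]
    nlinarith
  have hK32 := three_halves_le_doubling hS hA2 hR hK
  have hlam := half_le_logb_two hK32
  have hkE := le_exp_of_logb_two_le (x := Real.logb 2 p)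
    (t := 20400 * (Real.logb 2 (Real.logb 2 p) ^ 3 * Real.logb 2 K ^ 2)) (by linarith)
    (by positivity)
  have hKE := le_exp_of_logb_two_le (x := K)
    (t := 20400 * (Real.logb 2 (Real.logb 2 p) ^ 3 * Real.logb 2 K ^ 2)) (by linarith)
    (by positivity)
  have hME := progression_loss_le hLL1 hK32 rfl rfl
  have hlog : Nat.log 2 p ≤ 2 ^ ⌈Real.logb 2 (Real.logb 2 p)⌉₊ := by
    have : (Nat.log 2 p : ℝ) ≤ 2 ^ ⌈Real.logb 2 (Real.logb 2 p)⌉₊ := by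
      rw [← Real.rpow_natCast]
      refine hk.trans (hpow.le.trans ?_)
      exact Real.rpow_le_rpow_of_exponent_le (by norm_num) (Nat.le_ceil _)
    exact_mod_cast this
  have hl : 1 ≤ ⌈Real.logb 2 (Real.logb 2 p)⌉₊ := Nat.ceil_pos.2 hLL
  have hΛ : 1 / 4 * Real.logb 2 (Real.logb 2 p) * (1 / 4) ≤
      Real.logb 2 (Real.logb 2 p) ^ 3 * Real.logb 2 K ^ 2 := by
    have h1 : 1 / 4 ≤ Real.logb 2 K ^ 2 := by nlinarith
    have h2 : 1 / 4 * Real.logb 2 (Real.logb 2 p) ≤ Real.logb 2 (Real.logb 2 p) ^ 3 := by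
      have : 1 / 4 ≤ Real.logb 2 (Real.logb 2 p) ^ 2 := by nlinarith
      nlinarith
    gcongr
  have hΛ' : 1 / 8 * (1 / 2 * Real.logb 2 K) ≤
      Real.logb 2 (Real.logb 2 p) ^ 3 * Real.logb 2 K ^ 2 := by
    have h1 : 1 / 2 * Real.logb 2 K ≤ Real.logb 2 K ^ 2 := by nlinarith
    have h2 : 1 / 8 ≤ Real.logb 2 (Real.logb 2 p) ^ 3 := by
      calc (1 / 8 : ℝ) = (1 / 2) ^ 3 := by norm_num
        _ ≤ _ := by gcongr
    gcongr
  have hE : 2 ^ 60 ≤ Real.exp (20400 * (Real.logb 2 (Real.logb 2 p) ^ 3 * Real.logb 2 K ^ 2)) := by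
    refine le_exp_of_logb_two_le (by norm_num) (by positivity) ?_
    rw [Real.logb_pow, Real.logb_self_eq_one (by norm_num)]
    push_cast
    linarith
  have key := card_mul_card_pow_three_le hp2 hS hA hK1 hK hdir hR hl (Nat.le_ceil _) hlog hE
    (hk.trans (hkE (by linarith))) (hKE (by linarith)) hME
  have hA0 : (0 : ℝ) < #A := by exact_mod_cast hA.card_pos
  rw [← Real.exp_nat_mul] at key
  have hexp : ((14 : ℕ) : ℝ) * (20400 * (Real.logb 2 (Real.logb 2 p) ^ 3 * Real.logb 2 K ^ 2)) =
      285600 * Real.logb 2 (Real.logb 2 p) ^ 3 * Real.logb 2 K ^ 2 := by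
    push_cast
    ring
  rw [hexp] at key
  have hX := Real.exp_pos (285600 * Real.logb 2 (Real.logb 2 p) ^ 3 * Real.logb 2 K ^ 2)
  generalize Real.exp (285600 * Real.logb 2 (Real.logb 2 p) ^ 3 * Real.logb 2 K ^ 2) = X at key hX ⊢
  have hA3 : (0 : ℝ) < (#A : ℝ) ^ 3 := pow_pos hA0 3
  have hnonneg : 0 ≤ (p : ℝ) * X / (#A : ℝ) ^ 3 :=
    div_nonneg (mul_nonneg (Nat.cast_nonneg p) hX.le) hA3.le
  calc (#S : ℝ) ≤ p * X / (#A : ℝ) ^ 3 := (le_div_iff₀ hA3).2 key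
    _ ≤ 285600 * (p * X / (#A : ℝ) ^ 3) := le_mul_of_one_le_left hnonneg (by norm_num)
    _ = 285600 * ((p : ℝ) / (#A : ℝ) ^ 3) * X := by ring
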